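/- arXiv:2101.11886 — 9 statements merged into one kernel-verified Lean document; each statement's English description precedes it below -/
import Mathlib

section
/- For any even n ≥ 6 and n/2 + 1 ≤ p ≤ n−2, with r' = Σ_{i=0}^{p−n/2} C(n,i) + C(n−1, p−n/2), the b-chromatic number of Q_n^p satisfies b(Q_n^p) ≤ 2^{n−1} + ⌈r'/2⌉ − 1; equivalently, Q_n^p admits no b-coloring with more than 2^{n−1} + ⌈r'/2⌉ − 1 colors. -/
open Finset

/-- Strict simplicial order on subsets of `[n]` (as `Finset (Fin n)`):
`x` precedes `y` iff `|x| < |y|`, or `|x| = |y|` and `min (x ∆ y) ∈ x`. -/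
def SimpLT {n : ℕ} (x y : Finset (Fin n)) : Prop :=
  x.card < y.card ∨
    (x.card = y.card ∧ ∃ i, i ∈ x ∧ i ∉ y ∧ ∀ j ∈ symmDiff x y, i ≤ j)

instance {n : ℕ} (x y : Finset (Fin n)) : Decidable (SimpLT x y) := by
  unfold SimpLT; infer_instance

/-- `ISeg n m` : the initial segment consisting of the first `m` subsets of `[n]`
in the simplicial ordering (the sets having fewer than `m` strict predecessors). -/
def ISeg (n m : ℕ) : Finset (Finset (Fin n)) :=
  Finset.univ.filter fun x => (Finset.univ.filter fun z => SimpLT z x).card < m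

/-- `Cball n p A` : the set `C^p[A]` of all subsets of `[n]` at symmetric-difference
distance at most `p` from every member of `A`. -/
def Cball (n p : ℕ) (A : Finset (Finset (Fin n))) : Finset (Finset (Fin n)) :=
  Finset.univ.filter fun y => ∀ x ∈ A, (symmDiff x y).card ≤ p

/-- `Cpunct n p A` : the set `C^p(A) = C^p[A] \ A`. -/
def Cpunct (n p : ℕ) (A : Finset (Finset (Fin n))) : Finset (Finset (Fin n)) :=
  Cball n p A \ A

/-- The `p`-th power of the hypercube `Q_n`: vertices are subsets of `[n]`,
adjacent iff the symmetric difference has size between `1` and `p`. -/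
def cubePow (n p : ℕ) : SimpleGraph (Finset (Fin n)) where
  Adj x y := 1 ≤ (symmDiff x y).card ∧ (symmDiff x y).card ≤ p
  symm := ⟨fun x y h => by simpa [symmDiff_comm] using h⟩
  loopless := ⟨fun x h => by simp [symmDiff_self] at h⟩

/-- `G` admits a b-coloring with `k` colors: a proper coloring with colors `Fin k`
such that every color class contains a vertex having a neighbor in each other
color class. -/
def HasBColoring {V : Type*} (G : SimpleGraph V) (k : ℕ) : Prop :=
  ∃ c : V → Fin k,
    (∀ x y, G.Adj x y → c x ≠ c y) ∧
    (∀ i : Fin k, ∃ v, c v = i ∧ ∀ j : Fin k, j ≠ i → ∃ w, G.Adj v w ∧ c w = j)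

/-- The `p`-th power of the Hamming graph `H_{n,q}`: vertices are `q`-ary `n`-tuples,
adjacent iff their Hamming distance is between `1` and `p`. -/
def hammingPow (n q p : ℕ) : SimpleGraph (Fin n → ZMod q) where
  Adj x y := 1 ≤ hammingDist x y ∧ hammingDist x y ≤ p
  symm := ⟨fun x y h => by simpa [hammingDist_comm] using h⟩
  loopless := ⟨fun x h => by simp at h⟩


open scoped FinsetFamily symmDiff

namespace UV

variable {α : Type*} [DecidableEq α] {u v a x y : Finset α} {A C s : Finset (Finset α)}

lemma IsCompressed.compress_mem (h : IsCompressed u v s) (ha : a ∈ s) : compress u v a ∈ s := by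
  have := compress_mem_compression (u := u) (v := v) ha
  rwa [h.eq] at this

lemma isCompressed_of_forall_compress_mem (h : ∀ a ∈ s, compress u v a ∈ s) :
    IsCompressed u v s := by
  ext a
  rw [mem_compression]
  constructor
  · rintro (h' | ⟨_, b, hb, rfl⟩)
    · exact h'.1
    · exact h b hb
  · exact fun ha => Or.inl ⟨ha, h a ha⟩

/-- Compressing along a pair with `#u < #v` either fixes a set or makes it smaller. -/
lemma card_compress_lt (huv : #u < #v) (h : compress u v a ≠ a) : #(compress u v a) < #a := by
  unfold compress at h ⊢
  split_ifs at h ⊢ with hc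
  · have h1 := card_sdiff_of_subset (s := v) (t := a ∪ u) (hc.2.trans subset_union_left)
    have h2 := card_union_le a u
    have h3 := card_le_card (s := v) (t := a ∪ u) (hc.2.trans subset_union_left)
    simp only [sup_eq_union]
    omega
  · exact absurd rfl h

lemma sum_card_compression (u v : Finset α) (s : Finset (Finset α)) :
    ∑ a ∈ 𝓒 u v s, #a =
      ∑ a ∈ s with compress u v a ∈ s, #a +
        ∑ a ∈ s with compress u v a ∉ s, #(compress u v a) := by
  rw [compression, sum_union compress_disjoint, filter_image, sum_image compress_injOn]

lemma sum_card_compression_le (huv : #u < #v) : ∑ a ∈ 𝓒 u v s, #a ≤ ∑ a ∈ s, #a := by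
  rw [sum_card_compression, ← sum_filter_add_sum_filter_not s (fun a => compress u v a ∈ s)]
  refine Nat.add_le_add_left (sum_le_sum fun a ha => ?_) _
  rw [mem_filter] at ha
  exact (card_compress_lt huv fun h => ha.2 (h.symm ▸ ha.1)).le

lemma sum_card_compression_lt (huv : #u < #v) (h : ¬ IsCompressed u v s) :
    ∑ a ∈ 𝓒 u v s, #a < ∑ a ∈ s, #a := by
  rw [sum_card_compression, ← sum_filter_add_sum_filter_not s (fun a => compress u v a ∈ s)]
  gcongr 1
  apply sum_lt_sum_of_nonempty
  · by_contra hne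
    rw [not_nonempty_iff_eq_empty, filter_eq_empty_iff] at hne
    exact h (isCompressed_of_forall_compress_mem fun a ha => not_not.1 (hne ha))
  · intro a ha
    rw [mem_filter] at ha
    exact card_compress_lt huv fun h => ha.2 (h.symm ▸ ha.1)

/-- Replacing `v` by `u` in `x` keeps the distance to a set `y` of a family `C` at most `p`, when
`C` is compressed along all smaller pairs and the compression of `y` lies in `C`. -/
lemma card_symmDiff_sup_sdiff_le {p : ℕ} (huv : Disjoint u v) (hlt : #u < #v)
    (hC : ∀ u' ⊆ u, ∀ v' ⊆ v, #u' < #v' → (u' ≠ u ∨ v' ≠ v) → IsCompressed u' v' C)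
    (hx : ∀ z ∈ C, #(x ∆ z) ≤ p) (hux : Disjoint u x) (hvx : v ⊆ x)
    (hy : y ∈ C) (hcy : compress u v y ∈ C) : #(((x ⊔ u) \ v) ∆ y) ≤ p := by
  rcases (v ∩ y).eq_empty_or_nonempty with h0 | h0
  · refine le_trans ?_ (hx y hy)
    have h1 : ((x ⊔ u) \ v) ∆ y ⊆ ((x ∆ y) \ v) ∪ u := by
      intro i hi
      have : i ∉ v ∩ y := by simp [h0]
      simp only [mem_symmDiff, mem_sdiff, mem_union, sup_eq_union, mem_inter] at *
      tauto
    have h2 : v ⊆ x ∆ y := by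
      intro i hi
      have h3 : i ∉ v ∩ y := by simp [h0]
      have := hvx hi
      simp only [mem_symmDiff, mem_inter] at *
      tauto
    have := card_le_card h1
    have := card_union_le ((x ∆ y) \ v) u
    have := card_sdiff_of_subset h2
    have := card_le_card h2
    omega
  obtain ⟨u', hu', hcard⟩ := exists_subset_card_eq
    (s := u \ y) (n := min #(u \ y) (#(v ∩ y) - 1)) (min_le_left _ _)
  have hpos := h0.card_pos
  have hz : compress u' (v ∩ y) y ∈ C := by
    by_cases h : u' = u ∧ v ∩ y = v
    · rwa [h.1, h.2]
    · exact (hC u' (hu'.trans sdiff_subset) (v ∩ y) inter_subset_left (by omega)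
        (by tauto)).compress_mem hy
  have hdis : Disjoint u' y := disjoint_of_subset_left hu' sdiff_disjoint
  rw [compress_of_disjoint_of_le hdis inter_subset_right] at hz
  refine le_trans ?_ (hx _ hz)
  have hmem : ∀ i, (i ∈ u → i ∉ v) ∧ (i ∈ u → i ∉ x) ∧ (i ∈ v → i ∈ x) ∧
      (i ∈ u' → i ∈ u ∧ i ∉ y) := fun i =>
    ⟨fun h => disjoint_left.1 huv h, fun h => disjoint_left.1 hux h, fun h => hvx h,
      fun h => mem_sdiff.1 (hu' h)⟩
  have hl : ((x ⊔ u) \ v) ∆ y = ((x ∆ y) \ (u ∪ v)) ∪ ((u \ y) ∪ (v ∩ y)) := by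
    ext i
    obtain ⟨h1, h2, h3, h4⟩ := hmem i
    clear * - h1 h2 h3 h4
    simp only [mem_symmDiff, mem_sdiff, mem_union, sup_eq_union, mem_inter]
    grind
  have hr : x ∆ ((y ⊔ u') \ (v ∩ y)) = ((x ∆ y) \ (u ∪ v)) ∪ (((u ∩ y) ∪ u') ∪ v) := by
    ext i
    obtain ⟨h1, h2, h3, h4⟩ := hmem i
    clear * - h1 h2 h3 h4
    simp only [mem_symmDiff, mem_sdiff, mem_union, sup_eq_union, mem_inter]
    grind
  have d1 : Disjoint ((x ∆ y) \ (u ∪ v)) (((u ∩ y) ∪ u') ∪ v) := by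
    rw [disjoint_left]
    intro i
    obtain ⟨h1, h2, h3, h4⟩ := hmem i
    clear * - h1 h2 h3 h4
    simp only [mem_sdiff, mem_union, mem_inter]
    grind
  have d2 : Disjoint ((u ∩ y) ∪ u') v := by
    rw [disjoint_left]
    intro i
    obtain ⟨h1, h2, h3, h4⟩ := hmem i
    clear * - h1 h2 h3 h4
    simp only [mem_union, mem_inter]
    grind
  have d3 : Disjoint (u ∩ y) u' := by
    rw [disjoint_left]
    intro i
    obtain ⟨h1, h2, h3, h4⟩ := hmem i
    clear * - h1 h2 h3 h4
    simp only [mem_inter]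
    grind
  rw [hl, hr, card_union_of_disjoint d1, card_union_of_disjoint d2, card_union_of_disjoint d3]
  have := card_union_le ((x ∆ y) \ (u ∪ v)) ((u \ y) ∪ (v ∩ y))
  have := card_union_le (u \ y) (v ∩ y)
  have := card_sdiff_add_card_inter u y
  have := card_le_card (inter_subset_left (s₁ := v) (s₂ := y))
  omega

/-- Simultaneous compression of two families does not increase their cross-diameter. -/
lemma card_symmDiff_le_of_mem_compression {p : ℕ} (huv : Disjoint u v) (hlt : #u < #v)
    (hA : ∀ u' ⊆ u, ∀ v' ⊆ v, #u' < #v' → (u' ≠ u ∨ v' ≠ v) → IsCompressed u' v' A)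
    (hC : ∀ u' ⊆ u, ∀ v' ⊆ v, #u' < #v' → (u' ≠ u ∨ v' ≠ v) → IsCompressed u' v' C)
    (hAC : ∀ a ∈ A, ∀ b ∈ C, #(a ∆ b) ≤ p) :
    ∀ a ∈ 𝓒 u v A, ∀ b ∈ 𝓒 u v C, #(a ∆ b) ≤ p := by
  intro a ha b hb
  by_cases haA : a ∈ A <;> by_cases hbC : b ∈ C
  · exact hAC a haA b hbC
  · have hu := le_of_mem_compression_of_notMem hb hbC
    have hv := disjoint_of_mem_compression_of_notMem hb hbC
    have hm := sup_sdiff_mem_of_mem_compression_of_notMem hb hbC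
    have hca : compress u v a ∈ A := by
      rw [mem_compression] at ha
      tauto
    have := card_symmDiff_sup_sdiff_le huv hlt hA
      (fun z hz => by rw [symmDiff_comm]; exact hAC z hz _ hm)
      disjoint_sdiff (le_sdiff.2 ⟨le_sup_right, huv.symm⟩) haA hca
    rwa [sdiff_sup_cancel (le_sup_of_le_left hu), hv.symm.sup_sdiff_cancel_right,
      symmDiff_comm] at this
  · have hu := le_of_mem_compression_of_notMem ha haA
    have hv := disjoint_of_mem_compression_of_notMem ha haA
    have hm := sup_sdiff_mem_of_mem_compression_of_notMem ha haA
    have hcb : compress u v b ∈ C := by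
      rw [mem_compression] at hb
      tauto
    have := card_symmDiff_sup_sdiff_le huv hlt hC (hAC _ hm)
      disjoint_sdiff (le_sdiff.2 ⟨le_sup_right, huv.symm⟩) hbC hcb
    rwa [sdiff_sup_cancel (le_sup_of_le_left hu), hv.symm.sup_sdiff_cancel_right] at this
  · have hua := le_of_mem_compression_of_notMem ha haA
    have hva := disjoint_of_mem_compression_of_notMem ha haA
    have hub := le_of_mem_compression_of_notMem hb hbC
    have hvb := disjoint_of_mem_compression_of_notMem hb hbC
    have := hAC _ (sup_sdiff_mem_of_mem_compression_of_notMem ha haA) _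
      (sup_sdiff_mem_of_mem_compression_of_notMem hb hbC)
    refine le_trans (card_le_card ?_) this
    intro i
    have h1 : i ∈ u → i ∈ a := fun h => hua h
    have h2 : i ∈ u → i ∈ b := fun h => hub h
    have h3 : i ∈ v → i ∉ a := fun h => disjoint_left.1 hva h
    have h4 : i ∈ v → i ∉ b := fun h => disjoint_left.1 hvb h
    simp only [mem_symmDiff, mem_sdiff, mem_union, sup_eq_union]
    tauto

/-- A family compressed along all pairs with `#u < #v` is closed under passing to smaller sets. -/
lemma mem_of_card_lt_of_isCompressed
    (h : ∀ u v : Finset α, Disjoint u v → #u < #v → IsCompressed u v s)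
    (hx : x ∈ s) (hyx : #y < #x) : y ∈ s := by
  have hlt : #(y \ x) < #(x \ y) := by
    have h1 := card_sdiff_add_card_inter x y
    have h2 := card_sdiff_add_card_inter y x
    rw [inter_comm] at h2
    omega
  have := (h (y \ x) (x \ y) disjoint_sdiff_sdiff hlt).compress_mem hx
  rwa [compress_sdiff_sdiff] at this

end UV

/-- Two families can be replaced by families of the same sizes and no larger cross-diameter
which consist of all sets below some level and some sets of that level. -/
lemma exists_card_lt_closed_of_forall_card_symmDiff_le {α : Type*} [DecidableEq α] {p : ℕ}
    (A C : Finset (Finset α)) (hAC : ∀ a ∈ A, ∀ b ∈ C, #(a ∆ b) ≤ p) :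
    ∃ A' C' : Finset (Finset α), #A' = #A ∧ #C' = #C ∧ (∀ a ∈ A', ∀ b ∈ C', #(a ∆ b) ≤ p) ∧
      (∀ x ∈ A', ∀ y, #y < #x → y ∈ A') ∧ (∀ x ∈ C', ∀ y, #y < #x → y ∈ C') := by
  induction hw : (∑ a ∈ A, #a + ∑ a ∈ C, #a) using Nat.strong_induction_on generalizing A C with
  | _ w ih =>
  by_cases hst : ∀ N : ℕ, ∀ u v : Finset α, #u + #v = N → Disjoint u v → #u < #v →
      UV.IsCompressed u v A ∧ UV.IsCompressed u v C
  · exact ⟨A, C, rfl, rfl, hAC,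
      fun x hx y hy => UV.mem_of_card_lt_of_isCompressed
        (fun u v h1 h2 => (hst _ u v rfl h1 h2).1) hx hy,
      fun x hx y hy => UV.mem_of_card_lt_of_isCompressed
        (fun u v h1 h2 => (hst _ u v rfl h1 h2).2) hx hy⟩
  · classical
    rw [not_forall] at hst
    have hmin := fun N hN => not_not.1 (Nat.find_min (m := N) hst hN)
    have hfind := Nat.find_spec hst
    generalize Nat.find hst = N at hmin hfind
    push Not at hfind
    obtain ⟨u, v, hN, huv, hlt, hnot⟩ := hfind
    have hsmall : ∀ u' ⊆ u, ∀ v' ⊆ v, #u' < #v' → (u' ≠ u ∨ v' ≠ v) →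
        UV.IsCompressed u' v' A ∧ UV.IsCompressed u' v' C := by
      intro u' hu' v' hv' hlt' hne
      refine hmin (#u' + #v') ?_ u' v' rfl (huv.mono hu' hv') hlt'
      have h1 := card_le_card hu'
      have h2 := card_le_card hv'
      rw [← hN]
      rcases hne with hne | hne
      · have := card_lt_card (hu'.ssubset_of_ne hne)
        omega
      · have := card_lt_card (hv'.ssubset_of_ne hne)
        omega
    have hcross := UV.card_symmDiff_le_of_mem_compression huv hlt
      (fun u' hu' v' hv' h h' => (hsmall u' hu' v' hv' h h').1)
      (fun u' hu' v' hv' h h' => (hsmall u' hu' v' hv' h h').2) hAC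
    have hlt' : ∑ a ∈ 𝓒 u v A, #a + ∑ a ∈ 𝓒 u v C, #a < w := by
      rw [← hw]
      by_cases hA : UV.IsCompressed u v A
      · exact add_lt_add_of_le_of_lt (UV.sum_card_compression_le hlt)
          (UV.sum_card_compression_lt hlt (hnot hA))
      · exact add_lt_add_of_lt_of_le (UV.sum_card_compression_lt hlt hA)
          (UV.sum_card_compression_le hlt)
    obtain ⟨A', C', h1, h2, h3⟩ := ih _ hlt' _ _ hcross rfl
    exact ⟨A', C', by rw [h1, UV.card_compression], by rw [h2, UV.card_compression], h3⟩

/-- A family closed under passing to smaller sets which has at least `c` sets more than the ball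
of radius `t` contains at least `c` sets of size `t + 1`. -/
lemma le_card_slice_of_card_lt_closed {n t c : ℕ} {A : Finset (Finset (Fin n))}
    (hA : ∀ x ∈ A, ∀ y, #y < #x → y ∈ A) (hc : c ≤ n.choose (t + 1))
    (h : ∑ i ∈ range (t + 1), n.choose i + c ≤ #A) : c ≤ #(A.slice (t + 1)) := by
  by_cases hbig : ∃ x ∈ A, t + 1 < #x
  · obtain ⟨x, hx, hxt⟩ := hbig
    refine hc.trans ?_
    have : powersetCard (t + 1) (univ : Finset (Fin n)) ⊆ A.slice (t + 1) := by
      intro y hy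
      rw [mem_powersetCard] at hy
      exact mem_slice.2 ⟨hA x hx y (by omega), hy.2⟩
    simpa using card_le_card this
  · push Not at hbig
    have hsub : A ⊆ ((range (t + 1)).biUnion fun i => powersetCard i univ) ∪ A.slice (t + 1) := by
      intro x hx
      have := hbig x hx
      simp only [mem_union, mem_biUnion, mem_range, mem_powersetCard, subset_univ, true_and,
        mem_slice, exists_eq_right', hx]
      omega
    have h1 := (card_le_card hsub).trans (card_union_le _ _)
    have h2 : #((range (t + 1)).biUnion fun i => powersetCard i (univ : Finset (Fin n))) ≤
        ∑ i ∈ range (t + 1), n.choose i :=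
      card_biUnion_le.trans (by simp)
    omega

/-- Cross-intersecting families in the layers `s` and `r`: if the first is at least as large as
a star, then the second is at most as large as a star. -/
lemma card_le_of_cross_intersecting {n s r : ℕ} {A C : Finset (Finset (Fin n))}
    (hs : 1 ≤ s) (hr : 1 ≤ r) (hsr : s + r ≤ n)
    (hA : (A : Set (Finset (Fin n))).Sized s) (hC : (C : Set (Finset (Fin n))).Sized r)
    (hAC : ∀ a ∈ A, ∀ b ∈ C, ¬ Disjoint a b) (hcard : (n - 1).choose (s - 1) ≤ #A) :
    #C ≤ (n - 1).choose (r - 1) := by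
  have hsized : (Aᶜˢ : Set (Finset (Fin n))).Sized (n - s) := by
    simpa using hA.compls
  have hch : (n - 1).choose (n - s) = (n - 1).choose (s - 1) := by
    rw [← Nat.choose_symm (n := n - 1) (k := s - 1) (by omega)]
    congr 1
    omega
  have kk := kruskal_katona_lovasz_form (𝒜 := Aᶜˢ) (i := n - s - r) (r := n - s) (k := n - 1)
    (by omega) (by omega) (by omega) hsized (by rwa [hch, card_compls])
  rw [show n - s - (n - s - r) = r by omega] at kk
  have hshadow := hsized.shadow_iterate (k := n - s - r)
  rw [show n - s - (n - s - r) = r by omega] at hshadow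
  have hdisj : Disjoint C (∂^[n - s - r] Aᶜˢ) := by
    rw [disjoint_left]
    intro b hb hb'
    obtain ⟨a, ha, hba, -⟩ := mem_shadow_iterate_iff_exists_sdiff.1 hb'
    rw [mem_compls] at ha
    refine hAC _ ha b hb (disjoint_left.2 fun i hi hib => ?_)
    exact mem_compl.1 hi (hba hib)
  have hle : #(C ∪ ∂^[n - s - r] Aᶜˢ) ≤ n.choose r := by
    have : C ∪ ∂^[n - s - r] Aᶜˢ ⊆ powersetCard r univ := by
      intro b hb
      rw [mem_union] at hb
      rw [mem_powersetCard]
      exact ⟨subset_univ _, hb.elim (fun h => hC h) (fun h => hshadow h)⟩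
    simpa using card_le_card this
  rw [card_union_of_disjoint hdisj] at hle
  have hpas : n.choose r = (n - 1).choose (r - 1) + (n - 1).choose r := by
    obtain ⟨n, rfl⟩ : ∃ k, n = k + 1 := ⟨n - 1, by omega⟩
    obtain ⟨r, rfl⟩ : ∃ k, r = k + 1 := ⟨r - 1, by omega⟩
    exact Nat.choose_succ_succ n r
  omega

lemma sum_range_choose_add_choose_eq_two_pow (q : ℕ) :
    ∑ i ∈ range (q + 1), (2 * q + 2).choose i + (2 * q + 1).choose q = 2 ^ (2 * q + 1) := by
  have h := Nat.sum_range_choose_halfway q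
  have h1 : ∑ i ∈ range (q + 1), (2 * q + 2).choose i =
      ∑ i ∈ range q, (2 * q + 1).choose i + ∑ i ∈ range (q + 1), (2 * q + 1).choose i := by
    rw [sum_range_succ', sum_range_succ' (fun i => (2 * q + 1).choose i), ← add_assoc,
      ← sum_add_distrib]
    simp [Nat.choose_succ_succ]
  have h2 := sum_range_succ (fun i => (2 * q + 1).choose i) q
  rw [h1, pow_succ, pow_mul]
  norm_num
  omega

/-- The set of vertices within distance `m + t` of every member of a large family contains at most
half of the `2 m`-dimensional cube. -/
lemma card_le_two_pow_of_forall_card_symmDiff_le {m t : ℕ} (htm : t + 1 ≤ m)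
    {A C : Finset (Finset (Fin (2 * m)))}
    (hAC : ∀ a ∈ A, ∀ b ∈ C, #(a ∆ b) ≤ m + t)
    (hA : ∑ i ∈ range (t + 1), (2 * m).choose i + (2 * m - 1).choose t ≤ #A) :
    #C ≤ 2 ^ (2 * m - 1) := by
  obtain ⟨q, rfl⟩ : ∃ q, m = q + 1 := ⟨m - 1, by omega⟩
  obtain ⟨A', C', hA', hC', hAC', hAd, hCd⟩ :=
    exists_card_lt_closed_of_forall_card_symmDiff_le A C hAC
  rw [← hA'] at hA
  rw [← hC']
  have hpas : ∀ j, (2 * (q + 1)).choose (j + 1) =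
      (2 * (q + 1) - 1).choose j + (2 * (q + 1) - 1).choose (j + 1) := fun j =>
    Nat.choose_succ_succ (2 * q + 1) j
  have hslA := le_card_slice_of_card_lt_closed hAd (by rw [hpas]; omega) hA
  have hcross := card_le_of_cross_intersecting (s := t + 1) (r := q + 1) (by omega) (by omega)
    (by omega) (sized_slice (𝒜 := A')) (sized_slice (𝒜 := C'))
    (fun a ha b hb hab => by
      rw [mem_slice] at ha hb
      have := hAC' a ha.1 b hb.1
      rw [hab.symmDiff_eq_sup, sup_eq_union, card_union_of_disjoint hab] at this
      omega) hslA
  by_contra hlt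
  push Not at hlt
  have hsum := sum_range_choose_add_choose_eq_two_pow q
  have hpos : 0 < (2 * q + 1).choose (q + 1) := Nat.choose_pos (by omega)
  have hslC := le_card_slice_of_card_lt_closed (t := q) (c := (2 * q + 1).choose q + 1) hCd
    (by rw [hpas]; change _ ≤ (2 * q + 1).choose q + (2 * q + 1).choose (q + 1); omega)
    (by
      change 2 ^ (2 * q + 1) < _ at hlt
      change ∑ i ∈ range (q + 1), (2 * q + 2).choose i + _ ≤ _
      omega)
  change _ ≤ (2 * q + 1).choose q at hcross
  omega

/-- If `cubePow n p` has a b-coloring with `k` colors, then there are `k` vertices (one for each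
color) and at least `2 k - 2 ^ n` vertices (the singleton color classes) such that each of the
former is within distance `p` of each of the latter. -/
lemma HasBColoring.exists_card_symmDiff_le {n p k : ℕ} (h : HasBColoring (cubePow n p) k) :
    ∃ A C : Finset (Finset (Fin n)), 2 * k ≤ 2 ^ n + #A ∧ #C = k ∧
      ∀ a ∈ A, ∀ b ∈ C, #(a ∆ b) ≤ p := by
  obtain ⟨c, -, hb⟩ := h
  choose v hv hnb using hb
  have hinj : Function.Injective v := Function.LeftInverse.injective hv
  let S : Finset (Fin k) := {i | #{x | c x = i} = 1}
  refine ⟨S.image v, univ.image v, ?_, by simp [card_image_of_injective _ hinj], ?_⟩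
  · rw [card_image_of_injective _ hinj]
    have h1 : ∑ i : Fin k, #{x | c x = i} = 2 ^ n := by
      rw [← card_eq_sum_card_fiberwise (fun x _ => mem_coe.2 (mem_univ (c x)))]
      simp
    have h2 : #S = ∑ i : Fin k, if #{x | c x = i} = 1 then 1 else 0 := by
      simp [S]
    have h3 : ∑ _i : Fin k, 2 = 2 * k := by simp [mul_comm]
    rw [← h1, h2, ← h3, ← sum_add_distrib]
    refine sum_le_sum fun i _ => ?_
    have : 0 < #{x | c x = i} := card_pos.2 ⟨v i, by simp [hv]⟩
    split_ifs <;> omega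
  · simp only [mem_image, mem_univ, true_and]
    rintro _ ⟨i, hi, rfl⟩ _ ⟨j, rfl⟩
    rcases eq_or_ne i j with rfl | hij
    · simp
    obtain ⟨w, hw, hwi⟩ := hnb j i hij
    have hi' : #{x | c x = i} = 1 := (mem_filter.1 hi).2
    have : w = v i := card_le_one.1 hi'.le w (by simp [hwi]) (v i) (by simp [hv])
    rw [symmDiff_comm, ← this]
    exact hw.2

/-- For even `n ≥ 6` and `n/2 + 1 ≤ p ≤ n-2`, with
`r' = ∑_{i=0}^{p-n/2} C(n,i) + C(n-1, p-n/2)`, `Q_n^p` admits no b-coloring with more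
than `2^{n-1} + ⌈r'/2⌉ - 1` colors. -/
theorem stmt9 (n p : ℕ) (heven : Even n) (hn : 6 ≤ n)
    (hp1 : n / 2 + 1 ≤ p) (hp2 : p ≤ n - 2)
    (r' : ℕ)
    (hr : r' = (∑ i ∈ Finset.range (p - n / 2 + 1), Nat.choose n i)
            + Nat.choose (n - 1) (p - n / 2))
    (k : ℕ) (h : HasBColoring (cubePow n p) k) :
    k ≤ 2 ^ (n - 1) + (r' + 1) / 2 - 1 := by
  by_contra hk
  obtain ⟨m, rfl⟩ : ∃ m, n = 2 * m := ⟨n / 2, by have := heven.two_dvd; omega⟩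
  obtain ⟨t, rfl⟩ : ∃ t, p = m + t := ⟨p - m, by omega⟩
  rw [show m + t - 2 * m / 2 = t by omega] at hr
  obtain ⟨A, C, hA, hC, hAC⟩ := h.exists_card_symmDiff_le
  have hpow : 2 ^ (2 * m) = 2 * 2 ^ (2 * m - 1) := by
    rw [← pow_succ']
    congr 1
    omega
  have hpos : 0 < (2 * m - 1).choose t := Nat.choose_pos (by omega)
  have := card_le_two_pow_of_forall_card_symmDiff_le (by omega) hAC (by omega)
  omega
end

section
/- The b-chromatic number of the 5th power of the 7-dimensional hypercube satisfies b(Q_7^5) ≤ 2^6 + 9; equivalently, Q_7^5 admits no b-coloring with more than 73 colors. -/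
open Finset

/-- A lower bound for the size of the closed neighbourhood of `m ≤ 20` vertices in a disjoint union
of copies of the `n`-dimensional cube, `n ≤ 7`; the row index is `n` and the column index is `m`. -/
def cubeNbhdTable : List (List ℕ) :=
  [[0, 1, 2, 3, 4, 5, 6, 7, 8, 9, 10, 11, 12, 13, 14, 15, 16, 17, 18, 19, 20],
   [0, 2, 2, 4, 4, 6, 6, 8, 8, 10, 10, 12, 12, 14, 14, 16, 16, 18, 18, 20, 20],
   [0, 3, 4, 4, 4, 7, 8, 8, 8, 11, 12, 12, 12, 15, 16, 16, 16, 19, 20, 20, 20],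
   [0, 4, 6, 7, 7, 8, 8, 8, 8, 12, 14, 15, 15, 16, 16, 16, 16, 20, 22, 23, 23],
   [0, 5, 8, 10, 11, 11, 13, 14, 14, 15, 15, 15, 16, 16, 16, 16, 16, 21, 24, 26, 27],
   [0, 6, 10, 13, 15, 16, 16, 19, 21, 22, 22, 24, 25, 25, 26, 26, 26, 28, 29, 29, 30],
   [0, 7, 12, 16, 19, 21, 22, 22, 26, 29, 31, 32, 32, 35, 37, 38, 38, 40, 41, 41, 42],
   [0, 8, 14, 19, 23, 26, 28, 29, 29, 34, 38, 41, 43, 44, 44, 48, 51, 53, 54, 54, 57]]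

/-- The entry of `cubeNbhdTable` for `m` vertices in dimension `n`, or `0` outside the table. -/
def cubeNbhdBound (n m : ℕ) : ℕ := (cubeNbhdTable.getD n []).getD m 0

theorem cubeNbhdBound_zero_le (m : ℕ) : cubeNbhdBound 0 m ≤ m := by
  rcases lt_or_ge m 21 with hm | hm
  · revert m
    decide +kernel
  · simp [cubeNbhdBound, cubeNbhdTable, hm]

theorem cubeNbhdBound_succ_le (n i j : ℕ) (hn : n < 7) :
    cubeNbhdBound (n + 1) (i + j) ≤
      max (cubeNbhdBound n i) j + max (cubeNbhdBound n j) i := by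
  rcases lt_or_ge (i + j) 21 with hm | hm
  · have key : ∀ n < 7, ∀ i < 21, ∀ j < 21, i + j < 21 → cubeNbhdBound (n + 1) (i + j) ≤
        max (cubeNbhdBound n i) j + max (cubeNbhdBound n j) i := by
      decide +kernel
    exact key n hn i (by omega) j (by omega) hm
  · have : cubeNbhdBound (n + 1) (i + j) = 0 := by
      interval_cases n <;>
        simp [cubeNbhdBound, cubeNbhdTable, hm]
    omega

/-- Vertex isoperimetry in the cube: a family containing `𝒜` and everything obtained from members of
`𝒜` by flipping one element of `U` has at least `cubeNbhdBound #U #𝒜` members. -/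
theorem cubeNbhdBound_le_card {α : Type*} [DecidableEq α] (U : Finset α) (hU : #U ≤ 7)
    (𝒜 ℬ : Finset (Finset α)) (hsub : 𝒜 ⊆ ℬ)
    (hflip : ∀ x ∈ 𝒜, ∀ i ∈ U, symmDiff x {i} ∈ ℬ) :
    cubeNbhdBound #U #𝒜 ≤ #ℬ := by
  induction U using Finset.induction_on generalizing 𝒜 ℬ with
  | empty => exact (cubeNbhdBound_zero_le _).trans (card_le_card hsub)
  | insert a U ha ih =>
    rw [card_insert_of_notMem ha] at hU ⊢
    have flip_insert : ∀ (x : Finset α), ∀ i ∈ U,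
        symmDiff (insert a x) {i} = insert a (symmDiff x {i}) := by
      intro x i hi
      have : a ≠ i := fun h => ha (h ▸ hi)
      ext b
      simp only [mem_symmDiff, mem_insert, mem_singleton]
      grind
    have flip_notMem : ∀ x : Finset α, a ∉ x → ∀ i ∈ U, a ∉ symmDiff x {i} := by
      intro x hx i hi
      have : a ≠ i := fun h => ha (h ▸ hi)
      simp [mem_symmDiff, hx, this]
    have h0 := ih (by omega) (𝒜.nonMemberSubfamily a) (ℬ.nonMemberSubfamily a)
      (fun x hx => by
        rw [mem_nonMemberSubfamily] at hx ⊢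
        exact ⟨hsub hx.1, hx.2⟩)
      (fun x hx i hi => by
        rw [mem_nonMemberSubfamily] at hx ⊢
        exact ⟨hflip x hx.1 i (mem_insert_of_mem hi), flip_notMem x hx.2 i hi⟩)
    have h1 := ih (by omega) (𝒜.memberSubfamily a) (ℬ.memberSubfamily a)
      (fun x hx => by
        rw [mem_memberSubfamily] at hx ⊢
        exact ⟨hsub hx.1, hx.2⟩)
      (fun x hx i hi => by
        rw [mem_memberSubfamily] at hx ⊢
        refine ⟨?_, flip_notMem x hx.2 i hi⟩
        rw [← flip_insert x i hi]
        exact hflip _ hx.1 i (mem_insert_of_mem hi))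
    have h01 : #(𝒜.nonMemberSubfamily a) ≤ #(ℬ.memberSubfamily a) := by
      refine card_le_card fun x hx => ?_
      rw [mem_nonMemberSubfamily] at hx
      rw [mem_memberSubfamily]
      have e : symmDiff x {a} = insert a x := by
        ext b
        simp only [mem_symmDiff, mem_insert, mem_singleton]
        grind
      exact ⟨e ▸ hflip x hx.1 a (mem_insert_self a U), hx.2⟩
    have h10 : #(𝒜.memberSubfamily a) ≤ #(ℬ.nonMemberSubfamily a) := by
      refine card_le_card fun x hx => ?_
      rw [mem_memberSubfamily] at hx
      rw [mem_nonMemberSubfamily]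
      have e : symmDiff (insert a x) {a} = x := by
        ext b
        simp only [mem_symmDiff, mem_insert, mem_singleton]
        grind
      exact ⟨e ▸ hflip _ hx.1 a (mem_insert_self a U), hx.2⟩
    have hA := card_memberSubfamily_add_card_nonMemberSubfamily a 𝒜
    have hB := card_memberSubfamily_add_card_nonMemberSubfamily a ℬ
    have hs := cubeNbhdBound_succ_le #U #(𝒜.nonMemberSubfamily a) #(𝒜.memberSubfamily a) (by omega)
    rw [add_comm #(𝒜.nonMemberSubfamily a), hA] at hs
    omega

/-- Under a surjection with `k` values, at least `2 * k - #V` points are alone in their fibre. -/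
theorem two_mul_card_le_card_add_card_injective_fibers {V K : Type*} [Fintype V] [DecidableEq V]
    [Fintype K] [DecidableEq K] (c : V → K) (hc : Function.Surjective c) :
    2 * Fintype.card K ≤ Fintype.card V + #{v | ∀ w, c w = c v → w = v} := by
  have hV : Fintype.card V = ∑ i, #{v | c v = i} :=
    card_eq_sum_card_fiberwise (s := univ) (t := univ) (by simp)
  have hS := card_eq_sum_card_fiberwise (f := c) (t := univ)
    (s := ({v | ∀ w, c w = c v → w = v} : Finset V)) (by simp)
  rw [hV, hS, ← sum_add_distrib, mul_comm, ← smul_eq_mul, ← card_univ]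
  refine card_nsmul_le_sum _ _ _ fun i _ => ?_
  obtain ⟨v, rfl⟩ := hc i
  by_cases hv : ∀ w, c w = c v → w = v
  · have h1 : 0 < #{u | c u = c v} := card_pos.2 ⟨v, by simp⟩
    have h2 : 0 < #{u ∈ ({v | ∀ w, c w = c v → w = v} : Finset V) | c u = c v} :=
      card_pos.2 ⟨v, by simpa using hv⟩
    omega
  · push Not at hv
    obtain ⟨w, hw, hne⟩ := hv
    have : 1 < #{u | c u = c v} := one_lt_card.2 ⟨w, by simpa using hw, v, by simp, hne⟩
    omega

/-- `Q_7^5` admits no b-coloring with more than `2^6 + 9 = 73` colors. -/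
theorem stmt10 (k : ℕ) (h : HasBColoring (cubePow 7 5) k) : k ≤ 2 ^ 6 + 9 := by
  obtain ⟨c, -, hb⟩ := h
  choose b hcb hadj using hb
  by_contra! hk
  have hcard := two_mul_card_le_card_add_card_injective_fibers c fun i => ⟨b i, hcb i⟩
  simp only [Fintype.card_fin, Fintype.card_finset] at hcard
  obtain ⟨𝒜, h𝒜, h20⟩ := exists_subset_card_eq
    (s := ({v | ∀ w, c w = c v → w = v} : Finset (Finset (Fin 7)))) (n := 20) (by omega)
  have hclose : ∀ x ∈ 𝒜, ∀ i, #(symmDiff (b i) x) ≤ 5 := by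
    intro x hx i
    have hx' : ∀ w, c w = c x → w = x := by simpa using h𝒜 hx
    by_cases hi : c x = i
    · rw [← hx' (b i) ((hcb i).trans hi.symm)]
      simp
    · obtain ⟨w, hw, hcw⟩ := hadj i (c x) hi
      rw [hx' w hcw] at hw
      exact hw.2
  have hinj : Function.Injective fun i => (b i)ᶜ := fun i j hij => by
    rw [← hcb i, ← hcb j, compl_injective hij]
  have hT : #(univ.image fun i => (b i)ᶜ) = k := by
    rw [card_image_of_injective _ hinj, card_univ, Fintype.card_fin]
  have far : ∀ x : Finset (Fin 7), 5 < #(symmDiff xᶜ x) ∧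
      ∀ i, 5 < #(symmDiff xᶜ (symmDiff x {i})) := by
    decide +kernel
  have hiso := cubeNbhdBound_le_card (univ : Finset (Fin 7)) (by simp) 𝒜
    (univ.image fun i => (b i)ᶜ)ᶜ
    (fun x hx => by
      simp only [mem_compl, mem_image, mem_univ, true_and, not_exists]
      intro i hi
      have hbi : b i = xᶜ := by rw [← hi, compl_compl]
      have hle := hclose x hx i
      rw [hbi] at hle
      exact hle.not_gt (far x).1)
    (fun x hx j _ => by
      simp only [mem_compl, mem_image, mem_univ, true_and, not_exists]
      intro i hi
      have hbi : b i = symmDiff xᶜ {j} := by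
        rw [← compl_compl (b i), hi]
        ext a
        by_cases hx' : a ∈ x <;> simp [mem_symmDiff, hx']
      have hle := hclose x hx i
      rw [hbi, symmDiff_assoc, symmDiff_comm _ x] at hle
      exact hle.not_gt ((far x).2 j))
  rw [h20, card_compl, hT, card_univ, Fintype.card_fin, Fintype.card_finset, Fintype.card_fin] at hiso
  have h55 : 55 ≤ cubeNbhdBound 7 20 := by decide +kernel
  omega
end

section
/- For every odd n ≥ 5, the b-chromatic number of Q_n^{(n+1)/2} satisfies b(Q_n^{(n+1)/2}) ≤ 2^{n−1} + ⌊(n+1)/4⌋; equivalently, Q_n^{(n+1)/2} admits no b-coloring with more than 2^{n−1} + ⌊(n+1)/4⌋ colors. -/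
open Finset

open scoped FinsetFamily

/-- The closed `r`-neighborhood of a family of subsets of `[n]` in the hypercube. -/
def cubeNbhd (n r : ℕ) (A : Finset (Finset (Fin n))) : Finset (Finset (Fin n)) :=
  Finset.univ.filter fun y => ∃ x ∈ A, (symmDiff x y).card ≤ r

lemma mem_cubeNbhd {n r : ℕ} {A : Finset (Finset (Fin n))} {y : Finset (Fin n)} :
    y ∈ cubeNbhd n r A ↔ ∃ x ∈ A, (symmDiff x y).card ≤ r := by
  simp [cubeNbhd]

lemma mem_downCompression_iff {α : Type*} [DecidableEq α] {a : α} {A : Finset (Finset α)}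
    {s : Finset α} :
    s ∈ 𝓓 a A ↔ (a ∈ s ∧ s ∈ A ∧ s.erase a ∈ A) ∨ (a ∉ s ∧ (s ∈ A ∨ insert a s ∈ A)) := by
  rw [Down.mem_compression]
  by_cases h : a ∈ s
  · simp only [insert_eq_of_mem h, h]; tauto
  · simp only [erase_eq_of_notMem h, h]; tauto

lemma cubeNbhd_downCompression_subset {n r : ℕ} (a : Fin n) (A : Finset (Finset (Fin n))) :
    cubeNbhd n r (𝓓 a A) ⊆ 𝓓 a (cubeNbhd n r A) := by
  intro y hy
  obtain ⟨x, hx, hxy⟩ := mem_cubeNbhd.1 hy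
  have sub {z w : Finset (Fin n)} (h : symmDiff z w ⊆ symmDiff x y) :
      (symmDiff z w).card ≤ r := (card_le_card h).trans hxy
  have flip {z w : Finset (Fin n)} (hmem : a ∈ symmDiff x y)
      (h : symmDiff z w ⊆ insert a ((symmDiff x y).erase a)) :
      (symmDiff z w).card ≤ r := by
    rw [insert_erase hmem] at h
    exact sub h
  rw [mem_downCompression_iff] at hx ⊢
  simp only [mem_cubeNbhd]
  by_cases hay : a ∈ y
  · refine Or.inl ⟨hay, ?_⟩
    rcases hx with ⟨hax, h1, h2⟩ | ⟨hax, h⟩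
    · refine ⟨⟨x, h1, hxy⟩, ⟨x.erase a, h2, sub ?_⟩⟩
      intro b; simp only [mem_symmDiff, mem_erase]; tauto
    · have hmem : a ∈ symmDiff x y := by simp [mem_symmDiff, hay, hax]
      rcases h with h | h
      · refine ⟨⟨x, h, hxy⟩, ⟨x, h, sub ?_⟩⟩
        intro b; simp only [mem_symmDiff, mem_erase]; grind
      · refine ⟨⟨_, h, flip hmem ?_⟩, ⟨_, h, flip hmem ?_⟩⟩ <;>
        · intro b; simp only [mem_symmDiff, mem_erase, mem_insert]; grind
  · refine Or.inr ⟨hay, ?_⟩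
    rcases hx with ⟨hax, h1, h2⟩ | ⟨hax, h | h⟩
    · exact Or.inl ⟨x, h1, hxy⟩
    · exact Or.inl ⟨x, h, hxy⟩
    · refine Or.inr ⟨_, h, sub ?_⟩
      intro b; simp only [mem_symmDiff, mem_insert]; grind

lemma sum_card_downCompression_lt {α : Type*} [DecidableEq α] {a : α} {A : Finset (Finset α)}
    {s : Finset α} (hs : s ∈ A) (has : a ∈ s) (hsA : s.erase a ∉ A) :
    ∑ x ∈ 𝓓 a A, x.card < ∑ x ∈ A, x.card := by
  have himg : 𝓓 a A = A.image fun x => if x.erase a ∈ A then x else x.erase a := by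
    ext x
    rw [Down.mem_compression, mem_image]
    constructor
    · rintro (⟨h1, h2⟩ | ⟨h1, h2⟩)
      · exact ⟨x, h1, by simp [h2]⟩
      · have hax : a ∉ x := fun h => h1 (by rwa [insert_eq_of_mem h] at h2)
        exact ⟨insert a x, h2, by simp [erase_insert hax, h1]⟩
    · rintro ⟨y, hy, rfl⟩
      split_ifs with h
      · exact Or.inl ⟨hy, h⟩
      · have hay : a ∈ y := by
          by_contra h'
          exact h (by rwa [erase_eq_of_notMem h'])
        exact Or.inr ⟨h, by rwa [insert_erase hay]⟩
  have hinj : Set.InjOn (fun x : Finset α => if x.erase a ∈ A then x else x.erase a) A :=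
    card_image_iff.1 (by rw [← himg, Down.card_compression])
  rw [himg, sum_image hinj]
  refine sum_lt_sum (fun x _ => ?_) ⟨s, hs, ?_⟩
  · split_ifs
    · exact le_rfl
    · exact card_le_card (erase_subset _ _)
  · simpa [hsA] using card_erase_lt_of_mem has

/-- Every family can be compressed to a lower set of the same size whose neighborhoods
are not larger. -/
lemma exists_isLowerSet_card_cubeNbhd_le {n r : ℕ} (A : Finset (Finset (Fin n))) :
    ∃ B : Finset (Finset (Fin n)), IsLowerSet (B : Set (Finset (Fin n))) ∧
      B.card = A.card ∧ (cubeNbhd n r B).card ≤ (cubeNbhd n r A).card := by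
  induction hm : ∑ x ∈ A, x.card using Nat.strong_induction_on generalizing A with
  | _ m ih =>
    by_cases hA : ∀ s ∈ A, ∀ a ∈ s, s.erase a ∈ A
    · refine ⟨A, ?_, rfl, le_rfl⟩
      intro s t hts hs
      induction hd : (s \ t).card generalizing s with
      | zero =>
        have hst : s ⊆ t := sdiff_eq_empty_iff_subset.1 (card_eq_zero.1 hd)
        rwa [hst.antisymm hts] at hs
      | succ d ihd =>
        obtain ⟨a, ha⟩ := card_pos.1 (show 0 < (s \ t).card by omega)
        obtain ⟨has, hat⟩ := mem_sdiff.1 ha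
        refine ihd (subset_erase.2 ⟨hts, hat⟩) (hA s hs a has) ?_
        rw [erase_sdiff_comm, card_erase_of_mem ha]
        omega
    · push Not at hA
      obtain ⟨s, hs, a, has, hsA⟩ := hA
      obtain ⟨B, hB, hcard, hN⟩ :=
        ih _ (hm ▸ sum_card_downCompression_lt hs has hsA) (𝓓 a A) rfl
      refine ⟨B, hB, by rw [hcard, Down.card_compression], hN.trans ?_⟩
      rw [← Down.card_compression a (cubeNbhd n r A)]
      exact card_le_card (cubeNbhd_downCompression_subset a A)

/-- A family meeting every complementary pair contains at least half of all sets. -/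
lemma two_pow_le_two_mul_card_of_mem_or_compl_mem {n : ℕ} {F : Finset (Finset (Fin n))}
    (hF : ∀ y, y ∈ F ∨ yᶜ ∈ F) : 2 ^ n ≤ 2 * F.card := by
  have hsub : (univ : Finset (Finset (Fin n))) ⊆ F ∪ F.image compl := by
    intro y _
    rcases hF y with h | h
    · exact mem_union_left _ h
    · exact mem_union_right _ (mem_image.2 ⟨yᶜ, h, compl_compl y⟩)
  have h1 := (card_le_card hsub).trans (card_union_le _ _)
  have h2 : (F.image compl).card ≤ F.card := card_image_le
  simp only [card_univ, Fintype.card_finset, Fintype.card_fin] at h1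
  omega

lemma two_pow_le_of_isLowerSet {p r n : ℕ} (hp : p = r + 2) (hn : n = 2 * p - 1)
    {A : Finset (Finset (Fin n))} (hA : IsLowerSet (A : Set (Finset (Fin n))))
    (hcard : p + 1 ≤ A.card) : 2 ^ n ≤ 2 * ((cubeNbhd n r A).card + 1) := by
  have hlow {s t : Finset (Fin n)} (hs : s ∈ A) (hts : t ⊆ s) : t ∈ A := hA hts hs
  by_cases hbig : ∃ s ∈ A, 1 < s.card
  · obtain ⟨s, hs, hs1⟩ := hbig
    obtain ⟨t, hts, ht⟩ := exists_subset_card_eq (show 2 ≤ s.card by omega)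
    have hmem (y : Finset (Fin n)) (hy : (y \ t).card ≤ r) : y ∈ cubeNbhd n r A := by
      refine mem_cubeNbhd.2 ⟨y ∩ t, hlow hs (inter_subset_right.trans hts), ?_⟩
      convert hy using 2
      ext b; simp only [mem_symmDiff, mem_inter, mem_sdiff]; tauto
    have h := two_pow_le_two_mul_card_of_mem_or_compl_mem (F := cubeNbhd n r A) fun y => by
      by_contra! h
      have h1 : r < (y \ t).card := by
        by_contra! h'
        exact h.1 (hmem _ h')
      have h2 : r < (yᶜ \ t).card := by
        by_contra! h'
        exact h.2 (hmem _ h')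
      have h3 : (y \ t).card + (yᶜ \ t).card = tᶜ.card := by
        rw [← card_union_of_disjoint]
        · congr 1
          ext b; simp only [mem_union, mem_sdiff, mem_compl]; tauto
        · exact disjoint_compl_right.mono sdiff_subset sdiff_subset
      rw [card_compl, Fintype.card_fin, ht] at h3
      omega
    omega
  · push Not at hbig
    have hempty : ∅ ∈ A := by
      obtain ⟨s, hs⟩ := card_pos.1 (show 0 < A.card by omega)
      exact hlow hs (empty_subset _)
    set S : Finset (Fin n) := univ.filter fun i => {i} ∈ A with hS
    have hAS : A ⊆ insert ∅ (S.image singleton) := by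
      intro s hs
      rcases Nat.le_one_iff_eq_zero_or_eq_one.1 (hbig s hs) with h | h
      · simp [card_eq_zero.1 h]
      · obtain ⟨i, rfl⟩ := card_eq_one.1 h
        exact mem_insert_of_mem (mem_image_of_mem _ (by simpa [hS] using hs))
    have hScard : p ≤ S.card := by
      have h1 := (card_le_card hAS).trans (card_insert_le _ _)
      have h2 : (S.image (singleton : Fin n → Finset (Fin n))).card ≤ S.card := card_image_le
      omega
    have hmem (y : Finset (Fin n)) (hy : y.card ≤ r + 1) :
        y ∈ insert Sᶜ (cubeNbhd n r A) := by
      by_cases hdis : ∃ i ∈ y, i ∈ S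
      · obtain ⟨i, hiy, hiS⟩ := hdis
        refine mem_insert_of_mem (mem_cubeNbhd.2 ⟨{i}, (mem_filter.1 hiS).2, ?_⟩)
        have : symmDiff {i} y = y.erase i := by
          ext b; simp only [mem_symmDiff, mem_singleton, mem_erase]; grind
        rw [this, card_erase_of_mem hiy]
        omega
      · push Not at hdis
        by_cases hyr : y.card ≤ r
        · exact mem_insert_of_mem (mem_cubeNbhd.2 ⟨∅, hempty, by simpa [symmDiff_def] using hyr⟩)
        · have : y = Sᶜ := by
            refine eq_of_subset_of_card_le (fun i hi => mem_compl.2 (hdis i hi)) ?_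
            rw [card_compl, Fintype.card_fin]
            omega
          exact this ▸ mem_insert_self _ _
    have h := two_pow_le_two_mul_card_of_mem_or_compl_mem (F := insert Sᶜ (cubeNbhd n r A))
      fun y => by
        by_cases hy : y.card ≤ r + 1
        · exact Or.inl (hmem y hy)
        · refine Or.inr (hmem _ ?_)
          rw [card_compl, Fintype.card_fin]
          omega
    have := card_insert_le Sᶜ (cubeNbhd n r A)
    omega

lemma card_Cball_add_card_cubeNbhd {n p r : ℕ} (h : n = p + r + 1)
    (A : Finset (Finset (Fin n))) : (Cball n p A).card + (cubeNbhd n r A).card = 2 ^ n := by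
  have himg : (cubeNbhd n r A).image compl = (Cball n p A)ᶜ := by
    ext y
    have key (x : Finset (Fin n)) : (symmDiff x yᶜ).card + (symmDiff x y).card = n := by
      have : symmDiff x yᶜ = (symmDiff x y)ᶜ := by
        ext b; simp only [mem_symmDiff, mem_compl]; tauto
      rw [this, card_compl_add_card, Fintype.card_fin]
    have : y ∈ (cubeNbhd n r A).image compl ↔ yᶜ ∈ cubeNbhd n r A := by
      rw [mem_image]
      exact ⟨by rintro ⟨z, hz, rfl⟩; rwa [compl_compl], fun hy => ⟨yᶜ, hy, compl_compl y⟩⟩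
    rw [this, mem_cubeNbhd]
    simp only [Cball, mem_compl, mem_filter, mem_univ, true_and, not_forall, not_le,
      exists_prop]
    refine exists_congr fun x => and_congr_right fun _ => ?_
    have := key x
    omega
  rw [← card_image_of_injective (cubeNbhd n r A) compl_injective, himg, card_add_card_compl]
  simp

lemma card_Cball_le {n p : ℕ} (hp : 2 ≤ p) (hn : n = 2 * p - 1)
    {A : Finset (Finset (Fin n))} (hA : p + 1 ≤ A.card) :
    (Cball n p A).card ≤ 2 ^ (n - 1) + 1 := by
  obtain ⟨r, rfl⟩ := Nat.exists_eq_add_of_le' hp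
  obtain ⟨B, hB, hcard, hN⟩ := exists_isLowerSet_card_cubeNbhd_le (r := r) A
  have h1 := two_pow_le_of_isLowerSet rfl hn hB (hcard ▸ hA)
  have h2 := card_Cball_add_card_cubeNbhd (p := r + 2) (r := r) (by omega) A
  have h3 : 2 ^ n = 2 * 2 ^ (n - 1) := by
    rw [← pow_succ']; congr 1; omega
  omega

/-- The number of colors of a surjective coloring is at most half of the number of vertices
plus the number of vertices that are alone in their color class. -/
lemma two_mul_le_card_add_card_singleton_classes {V : Type*} [Fintype V] [DecidableEq V]
    {k : ℕ} {c : V → Fin k} (hc : Function.Surjective c) :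
    2 * k ≤ Fintype.card V + (univ.filter fun v => ∀ w, c w = c v → w = v).card := by
  set S := univ.filter fun v => ∀ w, c w = c v → w = v
  have h1 := card_eq_sum_card_fiberwise (s := univ) (t := univ) (f := c)
    (fun _ _ => mem_coe.2 (mem_univ _))
  have h2 := card_eq_sum_card_fiberwise (s := S) (t := univ) (f := c)
    (fun _ _ => mem_coe.2 (mem_univ _))
  rw [← card_univ, h1, h2, ← sum_add_distrib]
  calc 2 * k = ∑ _i : Fin k, 2 := by simp [mul_comm]
    _ ≤ _ := sum_le_sum fun i _ => by
      obtain ⟨v, rfl⟩ := hc i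
      have hv : v ∈ univ.filter fun w => c w = c v := by simp
      by_cases hS : v ∈ S
      · have hv' : v ∈ S.filter fun w => c w = c v := by simp [hS]
        have := card_pos.2 ⟨v, hv⟩
        have := card_pos.2 ⟨v, hv'⟩
        omega
      · simp only [S, mem_filter, mem_univ, true_and, not_forall] at hS
        obtain ⟨w, hw, hne⟩ := hS
        have := one_lt_card.2 ⟨v, hv, w, by simpa using hw, Ne.symm hne⟩
        omega

/-- For odd `n ≥ 5`, `Q_n^{(n+1)/2}` admits no b-coloring with more than
`2^{n-1} + ⌊(n+1)/4⌋` colors. -/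
theorem stmt11 (n : ℕ) (hodd : Odd n) (hn : 5 ≤ n) (k : ℕ)
    (h : HasBColoring (cubePow n ((n + 1) / 2)) k) :
    k ≤ 2 ^ (n - 1) + (n + 1) / 4 := by
  obtain ⟨m, hm⟩ := hodd
  obtain ⟨c, -, hdom⟩ := h
  choose v hv hadj using hdom
  set S := univ.filter fun x => ∀ w, c w = c x → w = x
  by_cases hcard : (n + 1) / 2 + 1 ≤ S.card
  · have hball := card_Cball_le (n := n) (p := (n + 1) / 2) (by omega) (by omega) hcard
    have hinj : Function.Injective v := Function.LeftInverse.injective hv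
    have hsub : univ.image v ⊆ Cball n ((n + 1) / 2) S := by
      intro y hy
      obtain ⟨i, -, rfl⟩ := mem_image.1 hy
      refine mem_filter.2 ⟨mem_univ _, fun x hx => ?_⟩
      have hx' : ∀ w, c w = c x → w = x := (mem_filter.1 hx).2
      by_cases hxi : c x = i
      · rw [hx' (v i) ((hv i).trans hxi.symm)]
        simp
      · obtain ⟨w, hw, hcw⟩ := hadj i (c x) hxi
        rw [← hx' w hcw, symmDiff_comm]
        exact hw.2
    have hk := card_le_card hsub
    rw [card_image_of_injective _ hinj, card_univ, Fintype.card_fin] at hk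
    omega
  · have hk : 2 * k ≤ Fintype.card (Finset (Fin n)) + S.card := by
      convert two_mul_le_card_add_card_singleton_classes (c := c) fun i => ⟨v i, hv i⟩
    rw [Fintype.card_finset, Fintype.card_fin] at hk
    have hpow : 2 ^ n = 2 * 2 ^ (n - 1) := by
      rw [← pow_succ']; congr 1; omega
    omega
end

section
/- For all integers n ≥ 9 and q with 3 ≤ q ≤ ⌈n/2⌉ − 2, the inequality Σ_{i=0}^{q} C(n,i) ≥ 3·C(q + ⌊n/2⌋, q) holds. -/
open Finset

lemma sum_range_choose_succ_succ (n q : ℕ) :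
    ∑ i ∈ range (q + 2), (n + 1).choose i =
      ∑ i ∈ range (q + 2), n.choose i + ∑ i ∈ range (q + 1), n.choose i := by
  rw [sum_range_succ', sum_range_succ' (n.choose ·) (q + 1)]
  simp only [Nat.choose_succ_succ, sum_add_distrib, Nat.choose_zero_right]
  ring

lemma sum_range_choose_add_two (n q : ℕ) :
    ∑ i ∈ range (q + 3), (n + 2).choose i =
      ∑ i ∈ range (q + 3), n.choose i + 2 * ∑ i ∈ range (q + 2), n.choose i +
        ∑ i ∈ range (q + 1), n.choose i := by
  rw [sum_range_choose_succ_succ (n + 1) (q + 1), sum_range_choose_succ_succ n (q + 1),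
    sum_range_choose_succ_succ n q]
  ring

lemma four_mul_centralBinom_le_four_pow {m : ℕ} (hm : 5 ≤ m) :
    4 * m.centralBinom ≤ 4 ^ m := by
  induction m, hm using Nat.le_induction with
  | base => decide
  | succ m _ ih =>
    have h := Nat.succ_mul_centralBinom_succ m
    have h' : (m + 1).centralBinom ≤ 4 * m.centralBinom := by
      refine Nat.le_of_mul_le_mul_left (c := m + 1) ?_ m.succ_pos
      nlinarith
    rw [pow_succ]
    omega

/-- The extremal case `q = m` of `three_mul_choose_le_sum_range_choose`, with `m + 1` for `m`. -/
lemma three_mul_choose_le_sum_range_choose_diag {m : ℕ} (hm : 4 ≤ m) :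
    3 * (m + (m + 1)).choose m ≤ ∑ i ∈ range (m + 1), (2 * (m + 1)).choose i := by
  have h1 := four_mul_centralBinom_le_four_pow (m := m + 1) (by omega)
  have h2 := Nat.sum_range_choose_halfway (m + 1)
  rw [sum_range_choose_succ_succ, sum_range_succ (fun i => (2 * (m + 1)).choose i) (m + 1)] at h2
  have h3 : (m + 1).centralBinom = 2 * (m + (m + 1)).choose m := by
    rw [Nat.centralBinom_eq_two_mul_choose, show 2 * (m + 1) = (2 * m + 1) + 1 by ring,
      Nat.choose_succ_succ, Nat.choose_symm_half, show m + (m + 1) = 2 * m + 1 by ring]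
    ring
  have h4 := Nat.centralBinom_eq_two_mul_choose (m + 1)
  omega

lemma three_mul_choose_le_sum_range_choose {m : ℕ} (hm : 5 ≤ m) :
    ∀ q, 3 ≤ q → q < m → 3 * (q + m).choose q ≤ ∑ i ∈ range (q + 1), (2 * m).choose i := by
  induction m, hm using Nat.le_induction with
  | base =>
    intro q h1 h2
    interval_cases q <;> decide
  | succ m hm ih =>
    intro q hq hqm
    obtain hlt | rfl := (Nat.lt_succ_iff_lt_or_eq).1 hqm
    swap
    · exact three_mul_choose_le_sum_range_choose_diag (by omega)
    obtain ⟨k, rfl⟩ : ∃ k, q = k + 2 := ⟨q - 2, by omega⟩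
    have h1 : 3 * (k + 2 + m).choose (k + 2) ≤ ∑ i ∈ range (k + 3), (2 * m).choose i :=
      ih (k + 2) hq hlt
    have hP : (k + 2 + (m + 1)).choose (k + 2) =
        (k + 2 + m).choose (k + 1) + (k + 2 + m).choose (k + 2) := Nat.choose_succ_succ _ _
    rw [show 2 * (m + 1) = 2 * m + 2 by ring, sum_range_choose_add_two, hP]
    suffices h : 3 * (k + 2 + m).choose (k + 1) ≤
        2 * ∑ i ∈ range (k + 2), (2 * m).choose i + ∑ i ∈ range (k + 1), (2 * m).choose i by
      omega
    obtain rfl | hk : k = 1 ∨ 2 ≤ k := by omega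
    · have h2 : (2 * m).choose 2 = m * (2 * m - 1) := by
        rw [Nat.choose_two_right, mul_assoc, Nat.mul_div_cancel_left _ two_pos]
      have h3 : 2 * (1 + 2 + m).choose 2 ≤ (m + 3) * (m + 2) := by
        rw [Nat.choose_two_right, show 1 + 2 + m = m + 3 by ring]
        exact Nat.mul_div_le _ 2
      obtain ⟨t, rfl⟩ : ∃ t, m = t + 5 := ⟨m - 5, by omega⟩
      rw [show 2 * (t + 5) - 1 = 2 * t + 9 by omega] at h2
      simp only [sum_range_succ, range_zero, sum_empty, Nat.choose_zero_right,
        Nat.choose_one_right, h2]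
      nlinarith
    · have h2 : 3 * (k + 1 + m).choose (k + 1) ≤ ∑ i ∈ range (k + 2), (2 * m).choose i :=
        ih (k + 1) (by omega) (by omega)
      have h3 : (k + 2 + m).choose (k + 1) =
          (k + 1 + m).choose k + (k + 1 + m).choose (k + 1) := by
        rw [show k + 2 + m = (k + 1 + m) + 1 by ring, Nat.choose_succ_succ]
      have h4 : (k + 1 + m).choose k ≤ (k + 1 + m).choose (k + 1) :=
        Nat.choose_le_succ_of_lt_half_left (by omega)
      omega

/-- For `n ≥ 9` and `3 ≤ q ≤ ⌈n/2⌉ - 2`, we have `∑_{i=0}^{q} C(n,i) ≥ 3·C(q + ⌊n/2⌋, q)`. -/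
theorem stmt12 (n q : ℕ) (hn : 9 ≤ n) (hq1 : 3 ≤ q) (hq2 : q ≤ (n + 1) / 2 - 2) :
    3 * Nat.choose (q + n / 2) q ≤ ∑ i ∈ Finset.range (q + 1), Nat.choose n i := by
  obtain rfl | hn' : n = 9 ∨ 10 ≤ n := by omega
  · obtain rfl : q = 3 := by omega
    decide
  · exact (three_mul_choose_le_sum_range_choose (m := n / 2) (by omega) q hq1 (by omega)).trans
      (sum_le_sum fun i _ => Nat.choose_le_choose i (by omega))
end

section
/- For odd n ≥ 5 and (n+1)/2 ≤ p ≤ n−2, with r = Σ_{i=0}^{p−(n−1)/2} C(n,i) and s = C(p, p−(n−1)/2), the b-chromatic number of Q_n^p satisfies b(Q_n^p) ≤ 2^{n−1} + ⌊(r−s)/2⌋; equivalently, Q_n^p admits no b-coloring with more than 2^{n−1} + ⌊(r−s)/2⌋ colors. -/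
open Finset

open scoped FinsetFamily

/-- Every member of `A` is at distance at most `p` from every member of `K`. -/
def CrossWithin {α : Type*} [DecidableEq α] (p : ℕ) (A K : Finset (Finset α)) : Prop :=
  ∀ a ∈ A, ∀ b ∈ K, #(symmDiff a b) ≤ p

section Compression

variable {α : Type*} [DecidableEq α]

lemma CrossWithin.symm {p : ℕ} {A K : Finset (Finset α)} (h : CrossWithin p A K) :
    CrossWithin p K A := fun a ha b hb => by
  rw [symmDiff_comm]; exact h b hb a ha

lemma compress_mem_of_isCompressed {U V x : Finset α} {A : Finset (Finset α)}
    (h : UV.IsCompressed U V A) (hx : x ∈ A) : UV.compress U V x ∈ A := by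
  have := UV.compress_mem_compression (u := U) (v := V) hx
  rwa [h.eq] at this

lemma card_eq_add_of_disjoint_parts {U V : Finset α} (hUV : Disjoint U V) (x : Finset α) :
    #x = #(x \ (U ∪ V)) + #(x ∩ U) + #(x ∩ V) := by
  have h1 := card_sdiff_add_card_inter x (U ∪ V)
  rw [inter_union_distrib_left, card_union_of_disjoint] at h1
  · omega
  · exact hUV.mono inter_subset_right inter_subset_right

/-- If `b` is not itself moved by the compression replacing `V` by `U`, then the compressed set
is no farther from `b` than a set arising from `a` by a strictly smaller compression. -/
lemma exists_smaller_compress {U V a b : Finset α} (hUV : Disjoint U V) (hlt : #U < #V)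
    (hUa : Disjoint U a) (hVa : V ⊆ a) (hb : ¬ (Disjoint U b ∧ V ⊆ b)) :
    ∃ U' V', U' ⊆ U ∧ V' ⊆ V ∧ (#U' < #V' ∨ (U' = ∅ ∧ V' = ∅)) ∧ #U' + #V' < #U + #V ∧
      #(symmDiff ((a ∪ U) \ V) b) ≤ #(symmDiff ((a ∪ U') \ V') b) := by
  obtain ⟨U', hU', hcard⟩ := exists_subset_card_eq
    (show min #(U \ b) (#(V ∩ b) - 1) ≤ #(U \ b) from min_le_left _ _)
  have hU1 := card_sdiff_add_card_inter U b
  have hV1 := card_sdiff_add_card_inter V b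
  have hne : 0 < #(U ∩ b) + #(V \ b) := by
    by_contra h0
    apply hb
    have h1 : #(U ∩ b) = 0 := by omega
    have h2 : #(V \ b) = 0 := by omega
    exact ⟨disjoint_iff_inter_eq_empty.2 (card_eq_zero.1 h1),
      sdiff_eq_empty_iff_subset.1 (card_eq_zero.1 h2)⟩
  refine ⟨U', V ∩ b, hU'.trans sdiff_subset, inter_subset_left, ?_, ?_, ?_⟩
  · rcases Nat.eq_zero_or_pos #(V ∩ b) with h | h
    · right
      exact ⟨card_eq_zero.1 (by omega), card_eq_zero.1 h⟩
    · left; omega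
  · omega
  · rw [card_eq_add_of_disjoint_parts hUV, card_eq_add_of_disjoint_parts hUV
      (symmDiff ((a ∪ U') \ (V ∩ b)) b)]
    have e1 : symmDiff ((a ∪ U) \ V) b \ (U ∪ V) =
        symmDiff ((a ∪ U') \ (V ∩ b)) b \ (U ∪ V) := by
      ext i
      have := @hU' i
      simp only [mem_sdiff, mem_symmDiff, mem_union, mem_inter] at this ⊢
      tauto
    have e2 : symmDiff ((a ∪ U) \ V) b ∩ U = U \ b := by
      ext i
      have : i ∈ U → i ∉ V := fun hi => Finset.disjoint_left.1 hUV hi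
      simp only [mem_sdiff, mem_symmDiff, mem_union, mem_inter]
      tauto
    have e3 : symmDiff ((a ∪ U) \ V) b ∩ V = V ∩ b := by
      ext i
      simp only [mem_sdiff, mem_symmDiff, mem_union, mem_inter]
      tauto
    have e4 : symmDiff ((a ∪ U') \ (V ∩ b)) b ∩ U = U' ∪ (U ∩ b) := by
      ext i
      have h1 : i ∈ U → i ∉ V := fun hi => Finset.disjoint_left.1 hUV hi
      have h2 : i ∈ U → i ∉ a := fun hi => Finset.disjoint_left.1 hUa hi
      have := @hU' i
      simp only [mem_sdiff, mem_symmDiff, mem_union, mem_inter] at this ⊢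
      tauto
    have e5 : symmDiff ((a ∪ U') \ (V ∩ b)) b ∩ V = V := by
      ext i
      have h2 := @hVa i
      simp only [mem_sdiff, mem_symmDiff, mem_union, mem_inter]
      tauto
    have e6 : #(U' ∪ (U ∩ b)) = #U' + #(U ∩ b) :=
      card_union_of_disjoint (Finset.disjoint_left.2 fun i hi hi' =>
        (mem_sdiff.1 (hU' hi)).2 (mem_inter.1 hi').2)
    rw [e1, e2, e3, e4, e5, e6]
    omega

/-- `F` is stable under all strictly smaller cardinality-decreasing compressions. -/
def StableBelow (U V : Finset α) (F : Finset (Finset α)) : Prop :=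
  ∀ U' V', U' ⊆ U → V' ⊆ V → #U' < #V' → #U' + #V' < #U + #V → UV.IsCompressed U' V' F

lemma card_symmDiff_le_of_new_of_old {p : ℕ} {U V : Finset α} (hUV : Disjoint U V)
    (hlt : #U < #V) {A K : Finset (Finset α)} (h : CrossWithin p A K) (hA : StableBelow U V A)
    {a b : Finset α} (ha : a ∈ A) (hUa : Disjoint U a) (hVa : V ⊆ a) (hb : b ∈ K)
    (hbc : UV.compress U V b ∈ K) : #(symmDiff ((a ∪ U) \ V) b) ≤ p := by
  by_cases hmov : Disjoint U b ∧ V ⊆ b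
  · rw [UV.compress_of_disjoint_of_le hmov.1 hmov.2, sup_eq_union] at hbc
    convert h a ha _ hbc using 2
    ext i
    have h1 : i ∈ U → i ∉ V := fun hi => Finset.disjoint_left.1 hUV hi
    have h2 : i ∈ U → i ∉ a := fun hi => Finset.disjoint_left.1 hUa hi
    have h3 : i ∈ U → i ∉ b := fun hi => Finset.disjoint_left.1 hmov.1 hi
    have h4 := @hVa i
    have h5 := @hmov.2 i
    simp only [mem_sdiff, mem_symmDiff, mem_union]
    clear hA h ha hb hbc
    by_cases hiU : i ∈ U <;> by_cases hiV : i ∈ V <;> simp_all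
  · obtain ⟨U', V', hU, hV, hc, hl, hd⟩ := exists_smaller_compress hUV hlt hUa hVa hmov
    refine hd.trans (h _ ?_ _ hb)
    rcases hc with hc | ⟨rfl, rfl⟩
    · have := compress_mem_of_isCompressed (hA U' V' hU hV hc hl) ha
      rwa [UV.compress_of_disjoint_of_le (hUa.mono_left hU) (hV.trans hVa)] at this
    · simpa using ha

lemma CrossWithin.compression {p : ℕ} {U V : Finset α} (hUV : Disjoint U V)
    (hlt : #U < #V) {A K : Finset (Finset α)} (h : CrossWithin p A K) (hA : StableBelow U V A)
    (hK : StableBelow U V K) : CrossWithin p (𝓒 U V A) (𝓒 U V K) := by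
  have key : ∀ {F : Finset (Finset α)} {x}, x ∈ 𝓒 U V F → (x ∈ F ∧ UV.compress U V x ∈ F) ∨
      ∃ y ∈ F, Disjoint U y ∧ V ⊆ y ∧ x = (y ∪ U) \ V := by
    intro F x hx
    rcases UV.mem_compression.1 hx with hx | ⟨hx, y, hy, hyx⟩
    · exact Or.inl hx
    · right
      unfold UV.compress at hyx
      split_ifs at hyx with hm
      · exact ⟨y, hy, hm.1, hm.2, hyx.symm⟩
      · exact absurd (hyx ▸ hy) hx
  intro a ha b hb
  rcases key ha with ⟨ha', hac⟩ | ⟨a, ha', hUa, hVa, rfl⟩ <;>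
    rcases key hb with ⟨hb', hbc⟩ | ⟨b, hb', hUb, hVb, rfl⟩
  · exact h a ha' b hb'
  · rw [symmDiff_comm]
    exact card_symmDiff_le_of_new_of_old hUV hlt h.symm hK hb' hUb hVb ha' hac
  · exact card_symmDiff_le_of_new_of_old hUV hlt h hA ha' hUa hVa hb' hbc
  · convert h a ha' b hb' using 2
    ext i
    have h2 : i ∈ U → i ∉ a := fun hi => Finset.disjoint_left.1 hUa hi
    have h3 : i ∈ U → i ∉ b := fun hi => Finset.disjoint_left.1 hUb hi
    have h4 := @hVa i
    have h5 := @hVb i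
    simp only [mem_sdiff, mem_symmDiff, mem_union]
    tauto

lemma card_compress_lt {U V x : Finset α} (hlt : #U < #V) (hx : UV.compress U V x ≠ x) :
    #(UV.compress U V x) < #x := by
  unfold UV.compress at hx ⊢
  split_ifs at hx ⊢ with hm
  · have h1 : V ⊆ x ∪ U := hm.2.trans subset_union_left
    have h2 := card_sdiff_add_card_eq_card h1
    have h3 := card_union_le x U
    rw [sup_eq_union]
    omega
  · exact absurd rfl hx

lemma sum_card_compression_lt {U V : Finset α} (hlt : #U < #V) {A : Finset (Finset α)}
    (hA : ¬ UV.IsCompressed U V A) : ∑ x ∈ 𝓒 U V A, #x < ∑ x ∈ A, #x := by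
  rw [UV.compression, sum_union UV.compress_disjoint, filter_image,
    sum_image UV.compress_injOn, ← sum_filter_add_sum_filter_not A (UV.compress U V · ∈ A)]
  refine Nat.add_lt_add_left (sum_lt_sum_of_nonempty ?_ ?_) _
  · by_contra hne
    rw [not_nonempty_iff_eq_empty] at hne
    apply hA
    have h2 : ∀ x ∈ A, UV.compress U V x ∈ A := by
      simpa [filter_eq_empty_iff] using hne
    rw [UV.IsCompressed, UV.compression, filter_image, hne, image_empty, union_empty,
      filter_true_of_mem h2]
  · intro x hx
    rw [mem_filter] at hx
    exact card_compress_lt hlt fun h => hx.2 (h.symm ▸ hx.1)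

lemma sum_card_compression_le {U V : Finset α} (hlt : #U < #V) (A : Finset (Finset α)) :
    ∑ x ∈ 𝓒 U V A, #x ≤ ∑ x ∈ A, #x := by
  by_cases hA : UV.IsCompressed U V A
  · rw [hA.eq]
  · exact (sum_card_compression_lt hlt hA).le

/-- Every member of cardinality larger than `#y` forces `y` to be a member. -/
def IsLayered (F : Finset (Finset α)) : Prop :=
  ∀ x ∈ F, ∀ y : Finset α, #y < #x → y ∈ F

/-- Cross-diameter version of Harper's theorem, after Frankl and Füredi: families within
distance `p` of each other may be replaced by layered families of the same sizes. -/
theorem CrossWithin.exists_isLayered [Fintype α] {p : ℕ} {A K : Finset (Finset α)}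
    (h : CrossWithin p A K) : ∃ A' K' : Finset (Finset α), #A' = #A ∧ #K' = #K ∧
      CrossWithin p A' K' ∧ IsLayered A' ∧ IsLayered K' := by
  classical
  induction hN : ∑ x ∈ A, #x + ∑ x ∈ K, #x using Nat.strong_induction_on generalizing A K with
  | _ N ih =>
  set bad : Finset (Finset α × Finset α) := univ.filter fun P =>
    Disjoint P.1 P.2 ∧ #P.1 < #P.2 ∧
      ¬ (UV.IsCompressed P.1 P.2 A ∧ UV.IsCompressed P.1 P.2 K) with hbad
  rcases bad.eq_empty_or_nonempty with hemp | hne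
  · have hst : ∀ U V : Finset α, Disjoint U V → #U < #V →
        UV.IsCompressed U V A ∧ UV.IsCompressed U V K := by
      intro U V hUV hlt
      by_contra hc
      have : (U, V) ∈ bad := by
        simp only [hbad, mem_filter, mem_univ, true_and]
        exact ⟨hUV, hlt, hc⟩
      simp [hemp] at this
    have hlt : ∀ x y : Finset α, #y < #x → #(y \ x) < #(x \ y) := by
      intro x y hxy
      have h1 := card_sdiff_add_card_inter x y
      have h2 := card_sdiff_add_card_inter y x
      rw [inter_comm] at h2
      omega
    refine ⟨A, K, rfl, rfl, h, fun x hx y hxy => ?_, fun x hx y hxy => ?_⟩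
    · rw [← UV.compress_sdiff_sdiff y x]
      exact compress_mem_of_isCompressed (hst _ _ disjoint_sdiff_sdiff (hlt x y hxy)).1 hx
    · rw [← UV.compress_sdiff_sdiff y x]
      exact compress_mem_of_isCompressed (hst _ _ disjoint_sdiff_sdiff (hlt x y hxy)).2 hx
  · obtain ⟨⟨U, V⟩, hP, hmin⟩ := exists_min_image bad (fun P => #P.1 + #P.2) hne
    have hP' := hP
    simp only [hbad, mem_filter, mem_univ, true_and] at hP'
    obtain ⟨hUV, hlt, hc⟩ := hP'
    have hst : ∀ U' V', U' ⊆ U → V' ⊆ V → #U' < #V' → #U' + #V' < #U + #V →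
        UV.IsCompressed U' V' A ∧ UV.IsCompressed U' V' K := by
      intro U' V' hU hV hl hs
      by_contra hc'
      have hm : (U', V') ∈ bad := by
        simp only [hbad, mem_filter, mem_univ, true_and]
        exact ⟨hUV.mono hU hV, hl, hc'⟩
      exact absurd (hmin _ hm) (not_le.2 hs)
    have hcross := h.compression hUV hlt (fun U' V' h1 h2 h3 h4 => (hst U' V' h1 h2 h3 h4).1)
      (fun U' V' h1 h2 h3 h4 => (hst U' V' h1 h2 h3 h4).2)
    have hA := sum_card_compression_le hlt A
    have hK := sum_card_compression_le hlt K
    have hdec : ∑ x ∈ 𝓒 U V A, #x + ∑ x ∈ 𝓒 U V K, #x < N := by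
      by_cases hcA : UV.IsCompressed U V A
      · have := sum_card_compression_lt hlt fun hcK => hc ⟨hcA, hcK⟩
        omega
      · have := sum_card_compression_lt hlt hcA
        omega
    obtain ⟨A', K', h1, h2, h3⟩ := ih _ hdec hcross rfl
    exact ⟨A', K', h1.trans (UV.card_compression _ _ _), h2.trans (UV.card_compression _ _ _), h3⟩

end Compression

section Binomial

lemma choose_succ_add_mul_choose_le (a b t : ℕ) :
    a.choose (t + 1) + b * a.choose t ≤ (a + b).choose (t + 1) := by
  induction b with
  | zero => simp
  | succ b ih =>
    have h1 := Nat.choose_succ_succ (a + b) t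
    have h2 : a.choose t ≤ (a + b).choose t := Nat.choose_le_choose t (Nat.le_add_right a b)
    rw [← add_assoc a b 1, Nat.add_mul]
    simp only [Nat.succ_eq_add_one] at h1
    omega

lemma three_mul_choose_le_sum_choose {m t : ℕ} (ht : 2 ≤ t) (htm : t + 1 ≤ m) :
    3 * (m + t).choose t ≤ ∑ i ∈ range (t + 1), (2 * m + 1).choose i + 2 := by
  obtain ⟨u, rfl⟩ : ∃ u, t = u + 1 := ⟨t - 1, by omega⟩
  have hpascal : (2 * m + 2).choose (u + 1) ≤ ∑ i ∈ range (u + 1 + 1), (2 * m + 1).choose i := by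
    rw [sum_range_succ, sum_range_succ, Nat.choose_succ_succ (2 * m + 1) u]
    simp only [Nat.succ_eq_add_one]
    omega
  rcases Nat.lt_or_ge u 2 with hu | hu
  · obtain rfl : u = 1 := by omega
    have h1 : (2 * m + 1).choose 2 * 2 = (2 * m + 1) * (2 * m) := by
      simpa using Nat.choose_succ_right_eq (2 * m + 1) 1
    have h2 : (m + 2).choose 2 * 2 = (m + 2) * (m + 1) := by
      simpa using Nat.choose_succ_right_eq (m + 2) 1
    simp only [sum_range_succ, sum_range_zero, Nat.choose_zero_right, Nat.choose_one_right]
    norm_num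
    nlinarith
  · rcases Nat.lt_or_ge m 5 with hm | hm
    · obtain rfl : m = 4 := by omega
      obtain rfl : u = 2 := by omega
      decide
    · obtain ⟨d, rfl⟩ : ∃ d, m = u + 2 + d := ⟨m - (u + 2), by omega⟩
      have h1 := choose_succ_add_mul_choose_le (u + 2 + d + (u + 1)) (d + 3) u
      rw [show u + 2 + d + (u + 1) + (d + 3) = 2 * (u + 2 + d) + 2 by ring] at h1
      have h2 := Nat.choose_succ_right_eq (u + 2 + d + (u + 1)) u
      rw [show u + 2 + d + (u + 1) - u = u + d + 3 by omega] at h2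
      set S := (u + 2 + d + (u + 1)).choose (u + 1)
      set T := (u + 2 + d + (u + 1)).choose u
      have h3 : 2 * (u + d + 3) ≤ (d + 3) * (u + 1) := by
        obtain ⟨v, rfl⟩ : ∃ v, u = v + 2 := ⟨u - 2, by omega⟩
        nlinarith [Nat.zero_le (d * v)]
      have h4 : 2 * S ≤ (d + 3) * T := by
        refine le_of_mul_le_mul_left ?_ (show 0 < u + d + 3 by omega)
        calc (u + d + 3) * (2 * S) = 2 * (u + d + 3) * S := by ring
          _ ≤ (d + 3) * (u + 1) * S := Nat.mul_le_mul_right _ h3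
          _ = (d + 3) * (S * (u + 1)) := by ring
          _ = (u + d + 3) * ((d + 3) * T) := by rw [h2]; ring
      omega

end Binomial

lemma card_filter_card_lt_le (n j : ℕ) :
    #(univ.filter fun x : Finset (Fin n) => #x < j) ≤ ∑ i ∈ range j, n.choose i := by
  have h : (univ.filter fun x : Finset (Fin n) => #x < j) ⊆
      (range j).biUnion fun i => powersetCard i univ := by
    intro x hx
    simpa [mem_powersetCard] using hx
  refine (card_le_card h).trans (card_biUnion_le.trans_eq ?_)
  simp

/-- The number of sets of size `m` all of whose `t`-subsets lie in a family `𝒰` of fewer than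
`C(m+t,t)` sets. -/
lemma card_le_of_shadow_subset {m t : ℕ} (ht : 1 ≤ t) (htm : t + 1 ≤ m)
    {B 𝒰 : Finset (Finset (Fin (2 * m + 1)))} (hB : ∀ y ∈ B, #y = m)
    (hsub : ∀ y ∈ B, ∀ x ⊆ y, #x = t → x ∈ 𝒰) (h𝒰 : #𝒰 < (m + t).choose t) :
    #B ≤ (∑ i ∈ range (t + 1), (2 * m + 1).choose i - (m + t).choose t) / 2 := by
  rcases Nat.lt_or_ge t 2 with h2 | h2
  · obtain rfl : t = 1 := by omega
    simp only [Nat.choose_one_right] at h𝒰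
    have hB1 : #B ≤ 1 := by
      set W : Finset (Fin (2 * m + 1)) := univ.filter fun i => {i} ∈ 𝒰
      have hW : #W ≤ #𝒰 := by
        refine card_le_card_of_injOn (fun i => {i}) (fun i hi => ?_) (fun i _ j _ h => ?_)
        · simpa [W] using hi
        · simpa using h
      have hBW : ∀ y ∈ B, y = W := by
        intro y hy
        refine eq_of_subset_of_card_le (fun i hi => ?_) (by rw [hB y hy]; omega)
        simp only [W, mem_filter, mem_univ, true_and]
        exact hsub y hy {i} (by simpa using hi) (by simp)
      exact card_le_one.2 fun y hy z hz => (hBW y hy).trans (hBW z hz).symm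
    simp only [sum_range_succ, sum_range_zero, Nat.choose_zero_right, Nat.choose_one_right]
    omega
  · have hBs : #B < (m + t).choose t := by
      by_contra hge
      have hsz : (B : Set (Finset (Fin (2 * m + 1)))).Sized m := fun y hy => hB y hy
      have hkk := kruskal_katona_lovasz_form (n := 2 * m + 1) (i := m - t) (r := m) (k := m + t)
        (by omega) (by omega) (by omega) hsz (by rw [Nat.choose_symm_add]; omega)
      rw [show m - (m - t) = t by omega] at hkk
      have : ∂^[m - t] B ⊆ 𝒰 := by
        intro x hx
        obtain ⟨y, hy, hxy, hc⟩ := mem_shadow_iterate_iff_exists_mem_card_add.1 hx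
        have := hB y hy
        exact hsub y hy x hxy (by omega)
      have := card_le_card this
      omega
    have := three_mul_choose_le_sum_choose h2 htm
    omega

lemma exists_card_eq_disjoint {n : ℕ} (x : Finset (Fin n)) {j : ℕ} (h : #x + j ≤ n) :
    ∃ y : Finset (Fin n), #y = j ∧ Disjoint x y := by
  obtain ⟨y, hy, hc⟩ := exists_subset_card_eq (s := xᶜ) (n := j)
    (by rw [card_compl, Fintype.card_fin]; omega)
  exact ⟨y, hc, (disjoint_compl_right).mono_right hy⟩

lemma card_symmDiff_of_disjoint {n : ℕ} {x y : Finset (Fin n)} (h : Disjoint x y) :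
    #(symmDiff x y) = #x + #y := by
  rw [h.symmDiff_eq_sup, sup_eq_union, card_union_of_disjoint h]

theorem IsLayered.card_le_of_crossWithin {m t : ℕ} (ht : 1 ≤ t) (htm : t + 1 ≤ m)
    {A K : Finset (Finset (Fin (2 * m + 1)))} (hA : IsLayered A) (hK : IsLayered K)
    (h : CrossWithin (m + t) A K)
    (hcard : ∑ i ∈ range (t + 1), (2 * m + 1).choose i - (m + t).choose t < #A) :
    #K ≤ 2 ^ (2 * m) +
      (∑ i ∈ range (t + 1), (2 * m + 1).choose i - (m + t).choose t) / 2 := by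
  have hs : (m + t).choose t ≤ (2 * m + 1).choose t := Nat.choose_le_choose t (by omega)
  have hsum := sum_range_succ (fun i => (2 * m + 1).choose i) t
  have hhalf : #(univ.filter fun x : Finset (Fin (2 * m + 1)) => #x < m + 1) ≤ 2 ^ (2 * m) := by
    refine (card_filter_card_lt_le _ _).trans_eq ?_
    rw [Nat.sum_range_choose_halfway, pow_mul]
    norm_num
  by_contra! hlarge
  obtain ⟨x, hxA, hxt⟩ : ∃ x ∈ A, t ≤ #x := by
    by_contra! hc
    have := (card_le_card fun x hx => mem_filter.2 ⟨mem_univ x, hc x hx⟩).trans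
      (card_filter_card_lt_le (2 * m + 1) t)
    omega
  obtain ⟨y, hyK, hym⟩ : ∃ y ∈ K, m + 1 ≤ #y := by
    by_contra! hc
    have := (card_le_card fun x hx => mem_filter.2 ⟨mem_univ x, hc x hx⟩).trans hhalf
    omega
  have hAle : ∀ x ∈ A, #x ≤ t := by
    intro x hx
    by_contra! hc
    obtain ⟨x', hx', hxc⟩ := exists_subset_card_eq (s := x) (n := t + 1) hc
    rcases eq_or_lt_of_le (Nat.succ_le_of_lt hc) with he | hl
    · obtain ⟨z, hz, hd⟩ := exists_card_eq_disjoint x (j := m) (by omega)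
      have := h x hx z (hK y hyK z (by omega))
      rw [card_symmDiff_of_disjoint hd] at this
      omega
    · obtain ⟨z, hz, hd⟩ := exists_card_eq_disjoint x' (j := m) (by omega)
      have := h x' (hA x hx x' (by omega)) z (hK y hyK z (by omega))
      rw [card_symmDiff_of_disjoint hd] at this
      omega
  have hKle : ∀ y ∈ K, #y ≤ m + 1 := by
    intro y hy
    by_contra! hc
    obtain ⟨x', hx', hxc⟩ := exists_subset_card_eq (s := x) (n := t) hxt
    obtain rfl : x' = x := eq_of_subset_of_card_le hx' (by have := hAle x hxA; omega)
    obtain ⟨z, hz, hd⟩ := exists_card_eq_disjoint x' (j := m + 1) (by omega)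
    have := h x' hxA z (hK y hy z (by omega))
    rw [card_symmDiff_of_disjoint hd] at this
    omega
  set 𝒰 := powersetCard t (univ : Finset (Fin (2 * m + 1))) \ A
  set B := (K.filter fun y => #y = m + 1).image compl
  have hBcard : #B = #(K.filter fun y => #y = m + 1) :=
    card_image_of_injective _ compl_injective
  have hKsplit : #K ≤ 2 ^ (2 * m) + #B := by
    rw [hBcard, ← card_filter_add_card_filter_not (s := K) (fun y => #y = m + 1), add_comm]
    refine Nat.add_le_add_right (le_trans (card_le_card fun y hy => ?_) hhalf) _
    rw [mem_filter] at hy ⊢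
    have := hKle y hy.1
    exact ⟨mem_univ _, by omega⟩
  have h𝒰 : #𝒰 < (m + t).choose t := by
    have h1 := card_sdiff_add_card_inter (powersetCard t (univ : Finset (Fin (2 * m + 1)))) A
    rw [card_powersetCard, card_univ, Fintype.card_fin] at h1
    have h2 : #A ≤ ∑ i ∈ range t, (2 * m + 1).choose i +
        #(powersetCard t (univ : Finset (Fin (2 * m + 1))) ∩ A) := by
      refine le_trans (card_le_card (t := (univ.filter fun x => #x < t) ∪
        (powersetCard t (univ : Finset (Fin (2 * m + 1))) ∩ A)) fun x hx => ?_)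
        ((card_union_le _ _).trans (Nat.add_le_add_right (card_filter_card_lt_le _ _) _))
      have := hAle x hx
      simp only [mem_union, mem_filter, mem_univ, true_and, mem_inter, mem_powersetCard,
        subset_univ, hx, and_true]
      omega
    change #(powersetCard t (univ : Finset (Fin (2 * m + 1))) \ A) < _
    omega
  have hfin := card_le_of_shadow_subset ht htm (B := B) (𝒰 := 𝒰) ?_ ?_ h𝒰
  · omega
  · intro y hy
    obtain ⟨z, hz, rfl⟩ := mem_image.1 hy
    rw [card_compl, Fintype.card_fin, (mem_filter.1 hz).2]
    omega
  · intro y hy x hxy hxc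
    obtain ⟨z, hz, rfl⟩ := mem_image.1 hy
    rw [mem_filter] at hz
    simp only [𝒰, mem_sdiff, mem_powersetCard, subset_univ, true_and]
    refine ⟨hxc, fun hxA => ?_⟩
    have := h x hxA z hz.1
    rw [card_symmDiff_of_disjoint (disjoint_compl_left.mono_left hxy)] at this
    omega

/-- A b-coloring with `k` colors has a set `A` of vertices forming singleton color classes and
a set `K` of at least `k` vertices, each adjacent or equal to every vertex of `A`. -/
lemma HasBColoring.exists_singletons {n p k : ℕ} (h : HasBColoring (cubePow n p) k) :
    ∃ A K : Finset (Finset (Fin n)), CrossWithin p A K ∧ k ≤ #K ∧ 2 * k ≤ 2 ^ n + #A := by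
  classical
  obtain ⟨c, -, hb⟩ := h
  choose v hv hw using hb
  refine ⟨univ.filter fun x => ∀ y, c y = c x → y = x, univ.image v, ?_, ?_, ?_⟩
  · intro a ha b hb
    obtain ⟨i, -, rfl⟩ := mem_image.1 hb
    simp only [mem_filter, mem_univ, true_and] at ha
    by_cases hi : c a = i
    · rw [ha (v i) ((hv i).trans hi.symm)]
      simp
    · obtain ⟨w, hadj, hcw⟩ := hw i (c a) hi
      rw [ha w hcw] at hadj
      rw [symmDiff_comm]
      exact hadj.2
  · rw [card_image_of_injective _ (Function.LeftInverse.injective hv)]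
    simp
  · set A := univ.filter fun x => ∀ y, c y = c x → y = x
    have h1 : ∑ i : Fin k, #(univ.filter fun x => c x = i) = 2 ^ n := by
      rw [← card_eq_sum_card_fiberwise (fun x _ => mem_univ (c x))]
      simp
    have h2 : ∑ i : Fin k, #(A.filter fun x => c x = i) = #A :=
      (card_eq_sum_card_fiberwise (fun x _ => mem_univ (c x))).symm
    have h3 : ∑ _i : Fin k, 2 = 2 * k := by simp [mul_comm]
    rw [← h1, ← h2, ← h3, ← sum_add_distrib]
    refine sum_le_sum fun i _ => ?_
    have hpos : 0 < #(univ.filter fun x => c x = i) :=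
      card_pos.2 ⟨v i, by simp [hv i]⟩
    by_cases hA : v i ∈ A
    · have : 0 < #(A.filter fun x => c x = i) := card_pos.2 ⟨v i, by simp [hv i, hA]⟩
      omega
    · simp only [A, mem_filter, mem_univ, true_and, not_forall] at hA
      obtain ⟨y, hy, hne⟩ := hA
      have : 1 < #(univ.filter fun x => c x = i) :=
        one_lt_card.2 ⟨y, by simp [hy, hv i], v i, by simp [hv i], hne⟩
      omega

/-- For odd `n ≥ 5` and `(n+1)/2 ≤ p ≤ n-2`, with `r = ∑_{i=0}^{p-(n-1)/2} C(n,i)` and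
`s = C(p, p-(n-1)/2)`, `Q_n^p` admits no b-coloring with more than
`2^{n-1} + ⌊(r-s)/2⌋` colors. -/
theorem stmt13 (n p : ℕ) (hodd : Odd n) (hn : 5 ≤ n)
    (hp1 : (n + 1) / 2 ≤ p) (hp2 : p ≤ n - 2)
    (r s : ℕ)
    (hr : r = ∑ i ∈ Finset.range (p - (n - 1) / 2 + 1), Nat.choose n i)
    (hs : s = Nat.choose p (p - (n - 1) / 2))
    (k : ℕ) (h : HasBColoring (cubePow n p) k) :
    k ≤ 2 ^ (n - 1) + (r - s) / 2 := by
  obtain ⟨m, rfl⟩ := hodd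
  obtain ⟨t, rfl⟩ : ∃ t, p = m + t := ⟨p - m, by omega⟩
  rw [show m + t - (2 * m + 1 - 1) / 2 = t by omega] at hr hs
  rw [show 2 * m + 1 - 1 = 2 * m by omega]
  obtain ⟨A, K, hcross, hkK, hkA⟩ := h.exists_singletons
  rcases Nat.lt_or_ge (r - s) #A with hlt | hle
  · obtain ⟨A', K', hA', hK', hc, hlA, hlK⟩ := hcross.exists_isLayered
    subst hr hs
    have := hlA.card_le_of_crossWithin (by omega) (by omega) hlK hc (by omega)
    omega
  · rw [pow_succ] at hkA
    omega
end

section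
/- For even n ≥ 6 and n/2 + 1 ≤ p ≤ n−2, with r' = Σ_{i=0}^{p−n/2} C(n,i) + C(n−1, p−n/2) and s' = C(p−1, p−n/2), the b-chromatic number of Q_n^p satisfies b(Q_n^p) ≤ 2^{n−1} + ⌊(r'−s')/2⌋; equivalently, Q_n^p admits no b-coloring with more than 2^{n−1} + ⌊(r'−s')/2⌋ colors. -/
open Finset

/-- `u` precedes the disjoint set `v`: it is smaller, or has the same size and contains the largest
element of `u ∪ v`. -/
def Precedes {n : ℕ} (u v : Finset (Fin n)) : Prop :=
  Disjoint u v ∧ (#u < #v ∨ #u = #v ∧ ∃ i ∈ u, ∀ j ∈ v, j < i)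

/-- An additive weight that is monotone for `Precedes`. -/
def precWeight {n : ℕ} (x : Finset (Fin n)) : ℤ := ∑ i ∈ x, ((2 : ℤ) ^ n - 2 ^ (i : ℕ))

theorem sum_two_pow_lt {n : ℕ} (v : Finset (Fin n)) (b : ℕ) (h : ∀ j ∈ v, (j : ℕ) < b) :
    ∑ j ∈ v, (2 : ℤ) ^ (j : ℕ) < 2 ^ b := by
  have h1 := Nat.geomSum_lt (m := 2) (n := b) (s := v.map Fin.valEmbedding) le_rfl (by
    intro k hk
    obtain ⟨j, hj, rfl⟩ := Finset.mem_map.1 hk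
    exact h j hj)
  rw [Finset.sum_map] at h1
  exact_mod_cast h1

theorem Precedes.precWeight_lt {n : ℕ} {u v : Finset (Fin n)} (h : Precedes u v) :
    precWeight u < precWeight v := by
  unfold precWeight
  simp only [Finset.sum_sub_distrib, Finset.sum_const, nsmul_eq_mul]
  have hpos : (0 : ℤ) ≤ ∑ i ∈ u, (2 : ℤ) ^ (i : ℕ) := Finset.sum_nonneg fun _ _ => by positivity
  rcases h.2 with hlt | ⟨heq, i, hi, hij⟩
  · have h1 := sum_two_pow_lt v n fun j _ => j.2
    have h2 : ((#u : ℤ) + 1) * 2 ^ n ≤ #v * 2 ^ n := by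
      gcongr
      exact_mod_cast hlt
    linarith
  · have h1 := sum_two_pow_lt v i fun j hj => hij j hj
    have h2 : (2 : ℤ) ^ (i : ℕ) ≤ ∑ i ∈ u, (2 : ℤ) ^ (i : ℕ) :=
      Finset.single_le_sum (f := fun i : Fin n => (2 : ℤ) ^ (i : ℕ))
        (fun _ _ => by positivity) hi
    rw [heq]
    linarith

theorem precedes_or_precedes {n : ℕ} {x z : Finset (Fin n)} (h : x ≠ z) :
    Precedes (x \ z) (z \ x) ∨ Precedes (z \ x) (x \ z) := by
  have hd : Disjoint (x \ z) (z \ x) := disjoint_sdiff_sdiff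
  rcases lt_trichotomy #(x \ z) #(z \ x) with hl | he | hl
  · exact Or.inl ⟨hd, Or.inl hl⟩
  · have hne : (symmDiff x z).Nonempty := by
      rw [Finset.nonempty_iff_ne_empty]
      intro h0
      exact h (symmDiff_eq_bot.1 h0)
    obtain ⟨i, hi, hmax⟩ := Finset.exists_max_image (symmDiff x z) id hne
    simp only [Finset.mem_symmDiff, id] at hi hmax
    rcases hi with ⟨hx, hz⟩ | ⟨hz, hx⟩
    · refine Or.inl ⟨hd, Or.inr ⟨he, i, by simp [hx, hz], fun j hj => ?_⟩⟩
      rw [Finset.mem_sdiff] at hj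
      refine lt_of_le_of_ne (hmax j (Or.inr hj)) ?_
      rintro rfl
      exact hz hj.1
    · refine Or.inr ⟨hd.symm, Or.inr ⟨he.symm, i, by simp [hx, hz], fun j hj => ?_⟩⟩
      rw [Finset.mem_sdiff] at hj
      refine lt_of_le_of_ne (hmax j (Or.inl hj)) ?_
      rintro rfl
      exact hx hj.1
  · exact Or.inr ⟨hd.symm, Or.inl hl⟩

theorem Precedes.card_le {n : ℕ} {u v : Finset (Fin n)} (h : Precedes u v) : #u ≤ #v := by
  rcases h.2 with h | h
  · exact h.le
  · exact h.1.le

theorem Precedes.erase_left {n : ℕ} {u v : Finset (Fin n)} (h : Precedes u v) {i : Fin n}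
    (hi : i ∈ u) : Precedes (u.erase i) v := by
  refine ⟨h.1.mono_left (Finset.erase_subset _ _), Or.inl ?_⟩
  exact (Finset.card_erase_lt_of_mem hi).trans_le h.card_le

theorem Precedes.exists_erase_right {n : ℕ} {u v : Finset (Fin n)} (h : Precedes u v) {j : Fin n}
    (hj : j ∈ v) : ∃ u' ⊆ u, #(u \ u') ≤ 1 ∧
      (Precedes u' (v.erase j) ∨ u' = ∅ ∧ v.erase j = ∅) := by
  have hcv := Finset.card_erase_add_one hj
  rcases h.2 with hlt | ⟨heq, i, hi, hij⟩
  · rcases u.eq_empty_or_nonempty with rfl | ⟨i, hi⟩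
    · refine ⟨∅, subset_rfl, by simp, ?_⟩
      rcases (v.erase j).eq_empty_or_nonempty with h0 | h0
      · exact Or.inr ⟨rfl, h0⟩
      · exact Or.inl ⟨Finset.disjoint_empty_left _, Or.inl (by simpa using h0.card_pos)⟩
    · have hcu := Finset.card_erase_add_one hi
      refine ⟨u.erase i, Finset.erase_subset _ _, ?_, Or.inl ⟨?_, Or.inl (by omega)⟩⟩
      · rw [Finset.sdiff_erase_self hi]; simp
      · exact h.1.mono (Finset.erase_subset _ _) (Finset.erase_subset _ _)
  · rcases (u.erase i).eq_empty_or_nonempty with h0 | ⟨i', hi'⟩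
    · have hcu := Finset.card_erase_add_one hi
      rw [h0] at hcu
      refine ⟨∅, by simp, by simp at hcu ⊢; omega, Or.inr ⟨rfl, ?_⟩⟩
      rw [← Finset.card_eq_zero]
      simp at hcu
      omega
    · rw [Finset.mem_erase] at hi'
      have hcu := Finset.card_erase_add_one hi'.2
      refine ⟨u.erase i', Finset.erase_subset _ _, ?_, Or.inl ⟨?_, Or.inr ⟨by omega, i, ?_, ?_⟩⟩⟩
      · rw [Finset.sdiff_erase_self hi'.2]; simp
      · exact h.1.mono (Finset.erase_subset _ _) (Finset.erase_subset _ _)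
      · exact Finset.mem_erase.2 ⟨hi'.1.symm, hi⟩
      · exact fun k hk => hij k (Finset.mem_of_mem_erase hk)

/-- `A` is closed under replacing `v` by `u`. -/
def ReplaceClosed {n : ℕ} (u v : Finset (Fin n)) (A : Finset (Finset (Fin n))) : Prop :=
  ∀ z ∈ A, Disjoint u z → v ⊆ z → (z ∪ u) \ v ∈ A

theorem replaceClosed_iff {n : ℕ} {u v : Finset (Fin n)} {A : Finset (Finset (Fin n))} :
    ReplaceClosed u v A ↔ ∀ z ∈ A, UV.compress u v z ∈ A := by
  refine forall₂_congr fun z hz => ?_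
  unfold UV.compress
  split_ifs with h
  · exact ⟨fun H => H h.1 h.2, fun H _ _ => H⟩
  · exact ⟨fun _ => hz, fun _ h1 h2 => absurd ⟨h1, h2⟩ h⟩

theorem replaceClosed_empty {n : ℕ} (A : Finset (Finset (Fin n))) : ReplaceClosed ∅ ∅ A := by
  intro z hz _ _
  simpa using hz

theorem card_le_of_subset_erase_union {α : Type*} [DecidableEq α] {S T U : Finset α} {j : α}
    (hj : j ∈ S) (hU : #U ≤ 1) (hT : T ⊆ S.erase j ∪ U) : #T ≤ #S := by
  have h1 := Finset.card_le_card hT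
  have h2 := Finset.card_union_le (S.erase j) U
  have h3 := Finset.card_erase_add_one hj
  omega

theorem mem_compression_iff {n : ℕ} {u v x : Finset (Fin n)} {A : Finset (Finset (Fin n))}
    (hx : x ∈ UV.compression u v A) :
    (x ∈ A ∧ (Disjoint u x → v ⊆ x → (x ∪ u) \ v ∈ A)) ∨
      ∃ z ∈ A, Disjoint u z ∧ v ⊆ z ∧ x = (z ∪ u) \ v := by
  rcases UV.mem_compression.1 hx with ⟨h1, h2⟩ | ⟨h1, z, hz, rfl⟩
  · refine Or.inl ⟨h1, fun h3 h4 => ?_⟩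
    rwa [UV.compress_of_disjoint_of_le h3 h4] at h2
  · unfold UV.compress at h1 ⊢
    split_ifs at h1 ⊢ with h
    · exact Or.inr ⟨z, hz, h.1, h.2, rfl⟩
    · exact absurd hz h1

/-- Compressing `A` towards a preceding set and `D` in the opposite direction does not decrease
their distance, provided that both are already closed under all shorter replacements. -/
theorem le_card_symmDiff_of_compression {n d : ℕ} {A D : Finset (Finset (Fin n))}
    (hAD : ∀ x ∈ A, ∀ y ∈ D, d ≤ #(symmDiff x y)) {u v : Finset (Fin n)} (huv : Precedes u v)
    (hcl : ∀ u' v', Precedes u' v' → #u' + #v' < #u + #v →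
      ReplaceClosed u' v' A ∧ ReplaceClosed v' u' D)
    {x y : Finset (Fin n)} (hx : x ∈ UV.compression u v A) (hy : y ∈ UV.compression v u D) :
    d ≤ #(symmDiff x y) := by
  have hcl1 : ∀ i ∈ u, ReplaceClosed (u.erase i) v A ∧ ReplaceClosed v (u.erase i) D := by
    intro i hi
    refine hcl _ _ (huv.erase_left hi) ?_
    have := Finset.card_erase_lt_of_mem hi
    omega
  have hcl2 : ∀ j ∈ v, ∃ u' ⊆ u, #(u \ u') ≤ 1 ∧
      ReplaceClosed u' (v.erase j) A ∧ ReplaceClosed (v.erase j) u' D := by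
    intro j hj
    obtain ⟨u', hu', h1, h2 | ⟨h2, h3⟩⟩ := huv.exists_erase_right hj
    · refine ⟨u', hu', h1, hcl _ _ h2 ?_⟩
      have := Finset.card_erase_lt_of_mem hj
      have := Finset.card_le_card hu'
      omega
    · refine ⟨u', hu', h1, ?_⟩
      rw [h2, h3]
      exact ⟨replaceClosed_empty A, replaceClosed_empty D⟩
  have hd : ∀ i, i ∈ u → i ∉ v := fun i hi hj => Finset.disjoint_left.1 huv.1 hi hj
  rcases mem_compression_iff hx with ⟨hxA, hxc⟩ | ⟨z, hz, hzu, hvz, rfl⟩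
  · rcases mem_compression_iff hy with ⟨hyD, hyc⟩ | ⟨w, hw, hwv, huw, rfl⟩
    · exact hAD x hxA y hyD
    · rw [Finset.disjoint_left] at hwv
      by_cases h1 : ∃ i ∈ u, i ∈ x
      · obtain ⟨i, hi, hix⟩ := h1
        have := hAD x hxA _ ((hcl1 i hi).2 w hw (Finset.disjoint_left.2 hwv)
          ((Finset.erase_subset _ _).trans huw))
        refine this.trans (Finset.card_le_card fun k => ?_)
        simp only [Finset.mem_symmDiff, Finset.mem_sdiff, Finset.mem_union, Finset.mem_erase]
        grind
      by_cases h2 : ∃ j ∈ v, j ∉ x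
      · obtain ⟨j, hj, hjx⟩ := h2
        obtain ⟨u', hu', hc, -, hD⟩ := hcl2 j hj
        have := hAD x hxA _ (hD w hw (Finset.disjoint_left.2 fun k hk =>
          hwv (Finset.mem_of_mem_erase hk)) (hu'.trans huw))
        refine this.trans (card_le_of_subset_erase_union (j := j) ?_ hc fun k => ?_)
        · simp only [Finset.mem_symmDiff, Finset.mem_sdiff, Finset.mem_union]
          grind
        · simp only [Finset.mem_symmDiff, Finset.mem_sdiff, Finset.mem_union, Finset.mem_erase]
          grind
      push Not at h1 h2
      have := hAD _ (hxc (Finset.disjoint_left.2 h1) h2) w hw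
      refine this.trans (Finset.card_le_card fun k => ?_)
      simp only [Finset.mem_symmDiff, Finset.mem_sdiff, Finset.mem_union]
      grind
  · rw [Finset.disjoint_left] at hzu
    rcases mem_compression_iff hy with ⟨hyD, hyc⟩ | ⟨w, hw, hwv, huw, rfl⟩
    · by_cases h1 : ∃ i ∈ u, i ∉ y
      · obtain ⟨i, hi, hiy⟩ := h1
        have := hAD _ ((hcl1 i hi).1 z hz (Finset.disjoint_left.2 fun k hk =>
          hzu (Finset.mem_of_mem_erase hk)) hvz) y hyD
        refine this.trans (Finset.card_le_card fun k => ?_)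
        simp only [Finset.mem_symmDiff, Finset.mem_sdiff, Finset.mem_union, Finset.mem_erase]
        grind
      by_cases h2 : ∃ j ∈ v, j ∈ y
      · obtain ⟨j, hj, hjy⟩ := h2
        obtain ⟨u', hu', hc, hA, -⟩ := hcl2 j hj
        have := hAD _ (hA z hz (Finset.disjoint_left.2 fun k hk => hzu (hu' hk))
          ((Finset.erase_subset _ _).trans hvz)) y hyD
        refine this.trans (card_le_of_subset_erase_union (j := j) ?_ hc fun k => ?_)
        · simp only [Finset.mem_symmDiff, Finset.mem_sdiff, Finset.mem_union]
          grind
        · simp only [Finset.mem_symmDiff, Finset.mem_sdiff, Finset.mem_union, Finset.mem_erase]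
          grind
      push Not at h1 h2
      have := hAD z hz _ (hyc (Finset.disjoint_left.2 h2) h1)
      refine this.trans (Finset.card_le_card fun k => ?_)
      simp only [Finset.mem_symmDiff, Finset.mem_sdiff, Finset.mem_union]
      grind
    · rw [Finset.disjoint_left] at hwv
      refine (hAD z hz w hw).trans (Finset.card_le_card fun k => ?_)
      simp only [Finset.mem_symmDiff, Finset.mem_sdiff, Finset.mem_union]
      grind

theorem precWeight_replace {n : ℕ} {u v z : Finset (Fin n)} (hu : Disjoint u z)
    (hv : v ⊆ z) :
    precWeight ((z ∪ u) \ v) = precWeight z + precWeight u - precWeight v := by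
  unfold precWeight
  rw [← Finset.sum_union hu.symm, eq_sub_iff_add_eq]
  exact Finset.sum_sdiff (hv.trans Finset.subset_union_left)

theorem sum_compression_eq {n : ℕ} (u v : Finset (Fin n)) (A : Finset (Finset (Fin n)))
    (f : Finset (Fin n) → ℤ) :
    ∑ x ∈ UV.compression u v A, f x =
      ∑ x ∈ A, if UV.compress u v x ∈ A then f x else f (UV.compress u v x) := by
  have h : UV.compression u v A = {a ∈ A | UV.compress u v a ∈ A} ∪
      {a ∈ A | UV.compress u v a ∉ A}.image (UV.compress u v) := by
    ext x
    rw [UV.mem_compression]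
    simp only [Finset.mem_union, Finset.mem_filter, Finset.mem_image]
    grind
  rw [h, Finset.sum_union, Finset.sum_image, Finset.sum_ite]
  · intro a ha b hb hab
    exact UV.compress_injOn (by simpa using ha) (by simpa using hb) hab
  · rw [Finset.disjoint_left]
    simp only [Finset.mem_filter, Finset.mem_image]
    grind

theorem sum_compression_le {n : ℕ} {u v : Finset (Fin n)} {A : Finset (Finset (Fin n))}
    {f : Finset (Fin n) → ℤ}
    (hf : ∀ z, Disjoint u z → v ⊆ z → f ((z ∪ u) \ v) < f z) :
    ∑ x ∈ UV.compression u v A, f x ≤ ∑ x ∈ A, f x ∧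
      (¬ ReplaceClosed u v A → ∑ x ∈ UV.compression u v A, f x < ∑ x ∈ A, f x) := by
  have hle : ∀ x ∈ A, (if UV.compress u v x ∈ A then f x else f (UV.compress u v x)) ≤ f x := by
    intro x _
    split_ifs with h1
    · exact le_rfl
    · unfold UV.compress
      split_ifs with h2
      · exact (hf x h2.1 h2.2).le
      · exact le_rfl
  rw [sum_compression_eq]
  refine ⟨Finset.sum_le_sum hle, fun hn => Finset.sum_lt_sum hle ?_⟩
  unfold ReplaceClosed at hn
  push Not at hn
  obtain ⟨z, hz, h1, h2, h3⟩ := hn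
  refine ⟨z, hz, ?_⟩
  rw [UV.compress_of_disjoint_of_le h1 h2]
  exact (if_neg h3).trans_lt (hf z h1 h2)

/-- Two families at a given distance can be replaced by families of the same sizes, at no smaller
distance, that are closed under all replacements in opposite directions. -/
theorem exists_replaceClosed {n d : ℕ} (A D : Finset (Finset (Fin n)))
    (hAD : ∀ x ∈ A, ∀ y ∈ D, d ≤ #(symmDiff x y)) :
    ∃ A' D' : Finset (Finset (Fin n)), #A' = #A ∧ #D' = #D ∧
      (∀ x ∈ A', ∀ y ∈ D', d ≤ #(symmDiff x y)) ∧ ∀ u v, Precedes u v → ReplaceClosed u v A' := by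
  classical
  let P : Finset (Finset (Finset (Fin n)) × Finset (Finset (Fin n))) :=
    {q | #q.1 = #A ∧ #q.2 = #D ∧ ∀ x ∈ q.1, ∀ y ∈ q.2, d ≤ #(symmDiff x y)}
  obtain ⟨⟨A', D'⟩, hmem, hmin⟩ := Finset.exists_min_image P
    (fun q => ∑ x ∈ q.1, precWeight x + ∑ x ∈ q.2, -precWeight x)
    ⟨(A, D), by simpa [P] using hAD⟩
  simp only [P, Finset.mem_filter, Finset.mem_univ, true_and] at hmem hmin
  obtain ⟨hA, hD, hdist⟩ := hmem
  refine ⟨A', D', hA, hD, hdist, ?_⟩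
  suffices H : ∀ s : ℕ, ∀ u v : Finset (Fin n), #u + #v = s → Precedes u v →
      ReplaceClosed u v A' ∧ ReplaceClosed v u D' from fun u v huv => (H _ u v rfl huv).1
  intro s
  induction s using Nat.strong_induction_on with
  | _ s ih =>
    rintro u v rfl huv
    have hstep := hmin (UV.compression u v A', UV.compression v u D')
      ⟨by rw [UV.card_compression, hA], by rw [UV.card_compression, hD], fun x hx y hy =>
        le_card_symmDiff_of_compression hdist huv (fun u' v' h1 h2 => ih _ h2 u' v' rfl h1) hx hy⟩
    have hw := huv.precWeight_lt
    have hAle := sum_compression_le (u := u) (v := v) (A := A') (f := precWeight)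
      fun z h1 h2 => by rw [precWeight_replace h1 h2]; linarith
    have hDle := sum_compression_le (u := v) (v := u) (A := D') (f := fun x => -precWeight x)
      fun z h1 h2 => by
        show -precWeight _ < -precWeight _
        rw [precWeight_replace h1 h2]; linarith
    simp only at hstep
    constructor
    · by_contra hn
      have := hAle.2 hn
      linarith [hDle.1]
    · by_contra hn
      have := hDle.2 hn
      linarith [hAle.1]

/-- A form of Harper's vertex-isoperimetric inequality. -/
theorem card_le_of_initial {n d : ℕ} {A D I : Finset (Finset (Fin n))}
    (hAD : ∀ x ∈ A, ∀ y ∈ D, d ≤ #(symmDiff x y)) (hcard : #I ≤ #A)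
    (hI : ∀ x ∈ I, ∀ z, Precedes (z \ x) (x \ z) → z ∈ I) :
    #D ≤ #{y : Finset (Fin n) | ∀ x ∈ I, d ≤ #(symmDiff x y)} := by
  obtain ⟨A', D', hA, hD, hdist, hcl⟩ := exists_replaceClosed A D hAD
  have hsub : I ⊆ A' := by
    intro x hx
    by_contra hxA
    obtain ⟨z, hz, hzI⟩ : ∃ z ∈ A', z ∉ I := by
      by_contra! hc
      have hlt : #A' < #I := Finset.card_lt_card ⟨hc, fun h => hxA (h hx)⟩
      omega
    have hne : x ≠ z := fun h => hzI (h ▸ hx)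
    rcases precedes_or_precedes hne with h | h
    · refine hxA ?_
      have := hcl _ _ h z hz Finset.sdiff_disjoint Finset.sdiff_subset
      convert this using 1
      ext k
      simp only [Finset.mem_sdiff, Finset.mem_union]
      tauto
    · exact hzI (hI x hx z h)
  rw [← hD]
  refine Finset.card_le_card fun y hy => ?_
  simp only [Finset.mem_filter, Finset.mem_univ, true_and]
  exact fun x hx => hdist x (hsub hx) y hy

theorem card_filter_mem_subset_insert {n : ℕ} (a : ℕ) (l : Fin n) (S : Finset (Fin n))
    (hl : l ∉ S) :
    #{y : Finset (Fin n) | #y = a + 1 ∧ l ∈ y ∧ y ⊆ insert l S} = (#S).choose a := by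
  rw [← Finset.card_powersetCard]
  refine Finset.card_bij' (fun y _ => y.erase l) (fun y _ => insert l y) ?_ ?_ ?_ ?_
  · intro y hy
    simp only [Finset.mem_filter, Finset.mem_univ, true_and] at hy
    rw [Finset.mem_powersetCard, Finset.card_erase_of_mem hy.2.1, hy.1]
    refine ⟨fun k hk => ?_, rfl⟩
    have h1 := Finset.mem_erase.1 hk
    exact (Finset.mem_insert.1 (hy.2.2 h1.2)).resolve_left h1.1
  · intro y hy
    rw [Finset.mem_powersetCard] at hy
    simp only [Finset.mem_filter, Finset.mem_univ, true_and]
    refine ⟨?_, Finset.mem_insert_self _ _, Finset.insert_subset_insert _ hy.1⟩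
    rw [Finset.card_insert_of_notMem fun h => hl (hy.1 h), hy.2]
  · intro y hy
    simp only [Finset.mem_filter, Finset.mem_univ, true_and] at hy
    exact Finset.insert_erase hy.2.1
  · intro y hy
    rw [Finset.mem_powersetCard] at hy
    exact Finset.erase_insert fun h => hl (hy.1 h)

theorem two_mul_card_upper_half (m : ℕ) (l : Fin (2 * m)) :
    2 * #{y : Finset (Fin (2 * m)) | m < #y ∨ #y = m ∧ l ∉ y} = 2 ^ (2 * m) := by
  set T : Finset (Finset (Fin (2 * m))) := {y | m < #y ∨ #y = m ∧ l ∉ y} with hT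
  have himg : Tᶜ = T.image compl := by
    ext y
    have hc : #yᶜ = 2 * m - #y := by rw [Finset.card_compl, Fintype.card_fin]
    have hy : #y ≤ 2 * m := by simpa using Finset.card_le_univ y
    have : y ∈ T.image compl ↔ yᶜ ∈ T := by
      simp only [Finset.mem_image]
      constructor
      · rintro ⟨z, hz, rfl⟩
        simpa using hz
      · exact fun h => ⟨yᶜ, h, compl_compl y⟩
    rw [this]
    simp only [hT, Finset.mem_compl, Finset.mem_filter, Finset.mem_univ, true_and, hc]
    by_cases hl : l ∈ y <;> simp [hl] <;> omega
  have h1 : #Tᶜ = #T := by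
    rw [himg]
    exact Finset.card_image_of_injective _ compl_injective
  have h2 := Finset.card_add_card_compl T
  rw [h1] at h2
  simp only [Fintype.card_finset, Fintype.card_fin] at h2
  omega

theorem add_mul_choose_le_choose_add (M s e : ℕ) :
    M.choose (s + 1) + e * M.choose s ≤ (M + e).choose (s + 1) := by
  induction e with
  | zero => simp
  | succ e ih =>
    rw [← add_assoc, Nat.choose_succ_succ', add_mul, one_mul]
    have := Nat.choose_le_choose s (Nat.le_add_right M e)
    omega

theorem three_mul_choose_le {m t : ℕ} (ht : 1 ≤ t) (htm : t + 2 ≤ m) :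
    3 * (m + t - 1).choose t ≤
      ∑ i ∈ Finset.range (t + 1), (2 * m).choose i + (2 * m - 1).choose t := by
  obtain ⟨s, rfl⟩ : ∃ s, t = s + 1 := ⟨t - 1, by omega⟩
  obtain ⟨e, rfl⟩ : ∃ e, m = s + 3 + e := ⟨m - (s + 3), by omega⟩
  rw [Finset.sum_range_succ, Finset.sum_range_succ]
  set M := s + 3 + e + (s + 1) - 1 with hM
  have h1 : M.choose (s + 1) ≤ (2 * (s + 3 + e) - 1).choose (s + 1) :=
    Nat.choose_le_choose _ (by omega)
  have h2 := add_mul_choose_le_choose_add M s (e + 4)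
  have h3 : (M + (e + 4)).choose (s + 1) =
      (2 * (s + 3 + e)).choose s + (2 * (s + 3 + e)).choose (s + 1) := by
    rw [← Nat.choose_succ_succ]
    congr 1
    omega
  have h4 : M.choose (s + 1) ≤ (e + 4) * M.choose s := by
    have h5 := Nat.choose_succ_right_eq M s
    have h6 : M - s = s + 3 + e := by omega
    rw [h6] at h5
    refine Nat.le_of_mul_le_mul_right (c := s + 1) ?_ (by omega)
    rw [h5]
    nlinarith [Nat.zero_le (M.choose s * (s * e)), Nat.zero_le (M.choose s * s),
      Nat.zero_le (M.choose s)]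
  omega

/-- The isoperimetric bound for an initial segment of the form: all sets of size at most `t`, and
those of size `t + 1` that contain the last element and a further large element. -/
theorem card_le_two_pow_add_choose {m t : ℕ} (ht : 1 ≤ t) (htm : t + 2 ≤ m)
    {A D : Finset (Finset (Fin (2 * m)))}
    (hAD : ∀ x ∈ A, ∀ y ∈ D, m - t ≤ #(symmDiff x y))
    (hA : ∑ i ∈ Finset.range (t + 1), (2 * m).choose i + (2 * m - 1).choose t
      - (m + t - 1).choose t ≤ #A) :
    #D ≤ 2 ^ (2 * m - 1) + (m + t - 1).choose t := by
  let l : Fin (2 * m) := ⟨2 * m - 1, by omega⟩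
  let S : Finset (Fin (2 * m)) := {i | (i : ℕ) < m + t - 1}
  let I : Finset (Finset (Fin (2 * m))) := {x | #x ≤ t ∨ #x = t + 1 ∧ l ∈ x ∧ ¬ x ⊆ insert l S}
  have hlS : l ∉ S := by simp only [S, l, Finset.mem_filter]; omega
  have hS : #S = m + t - 1 := by
    have h : S = (Finset.univ : Finset (Fin (m + t - 1))).map
        (Fin.castLEEmb (show m + t - 1 ≤ 2 * m by omega)) := by
      ext i
      simp only [S, Finset.mem_filter, Finset.mem_univ, true_and, Finset.mem_map]
      constructor
      · exact fun h => ⟨⟨i, h⟩, rfl⟩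
      · rintro ⟨j, rfl⟩
        exact j.2
    rw [h, Finset.card_map, Finset.card_univ, Fintype.card_fin]
  have hIcard : #I ≤ #A := by
    refine le_trans ?_ hA
    set F : Finset (Finset (Fin (2 * m))) :=
      (Finset.range (t + 1)).biUnion fun i => Finset.powersetCard i Finset.univ
    set G : Finset (Finset (Fin (2 * m))) :=
      {y | #y = t + 1 ∧ l ∈ y ∧ y ⊆ insert l (Finset.univ.erase l)} with hG
    set H : Finset (Finset (Fin (2 * m))) := {y | #y = t + 1 ∧ l ∈ y ∧ y ⊆ insert l S} with hH
    have hF : #F ≤ ∑ i ∈ Finset.range (t + 1), (2 * m).choose i := by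
      refine Finset.card_biUnion_le.trans (Finset.sum_le_sum fun i _ => ?_)
      simp
    have hGc : #G = (2 * m - 1).choose t := by
      rw [hG, card_filter_mem_subset_insert t l _ (Finset.notMem_erase _ _),
        Finset.card_erase_of_mem (Finset.mem_univ _)]
      simp
    have hHc : #H = (m + t - 1).choose t := by
      rw [hH, card_filter_mem_subset_insert t l _ hlS, hS]
    have hHG : H ⊆ G := by
      intro y
      simp only [hG, hH, Finset.mem_filter, Finset.insert_erase (Finset.mem_univ l)]
      exact fun h => ⟨h.1, h.2.1, h.2.2.1, Finset.subset_univ _⟩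
    have hIsub : I ⊆ F ∪ (G \ H) := by
      intro y
      simp only [I, F, hG, hH, Finset.mem_filter, Finset.mem_univ, true_and, Finset.mem_union,
        Finset.mem_biUnion, Finset.mem_range, Finset.mem_powersetCard, Finset.mem_sdiff,
        Finset.insert_erase (Finset.mem_univ l), Finset.subset_univ, and_true]
      rintro (h | h)
      · exact Or.inl ⟨#y, by omega, rfl⟩
      · exact Or.inr ⟨⟨h.1, h.2.1⟩, fun h' => h.2.2 h'.2.2⟩
    have h1 := Finset.card_le_card hIsub
    have h2 := Finset.card_union_le F (G \ H)
    have h3 := Finset.card_sdiff_of_subset hHG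
    have h4 := Finset.card_le_card hHG
    omega
  have hinit : ∀ x ∈ I, ∀ z, Precedes (z \ x) (x \ z) → z ∈ I := by
    intro x hx z hz
    have hc : #z + #(x \ z) = #x + #(z \ x) := by
      have h1 := Finset.card_sdiff_add_card_inter x z
      have h2 := Finset.card_sdiff_add_card_inter z x
      rw [Finset.inter_comm] at h2
      omega
    simp only [I, Finset.mem_filter, Finset.mem_univ, true_and] at hx ⊢
    have hle := hz.card_le
    rcases hx with hx | ⟨hx, hlx, hxS⟩
    · exact Or.inl (by omega)
    rcases hz.2 with h | ⟨h, i, hi, hmax⟩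
    · exact Or.inl (by omega)
    rw [Finset.mem_sdiff] at hi
    have hil : i ≠ l := fun h => hi.2 (h ▸ hlx)
    refine Or.inr ⟨by omega, ?_, fun hzS => ?_⟩
    · by_contra hlz
      have h1 := hmax l (Finset.mem_sdiff.2 ⟨hlx, hlz⟩)
      have h2 : (l : ℕ) < i := h1
      have h3 : (l : ℕ) = 2 * m - 1 := rfl
      omega
    · obtain ⟨j, hjx, hjS⟩ := Finset.not_subset.1 hxS
      have h1 : (j : ℕ) < i := hmax j (Finset.mem_sdiff.2 ⟨hjx, fun h => hjS (hzS h)⟩)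
      have h2 := (Finset.mem_insert.1 (hzS hi.1)).resolve_left hil
      refine hjS (Finset.mem_insert_of_mem ?_)
      simp only [S, Finset.mem_filter, Finset.mem_univ, true_and] at h2 ⊢
      omega
  refine (card_le_of_initial hAD hIcard hinit).trans ?_
  have hT := two_mul_card_upper_half m l
  set T : Finset (Finset (Fin (2 * m))) := {y | m < #y ∨ #y = m ∧ l ∉ y} with hTdef
  set K : Finset (Finset (Fin (2 * m))) := {y | #y = m - 1 + 1 ∧ l ∈ y ∧ y ⊆ insert l S} with hK
  have hKc : #K = (m + t - 1).choose t := by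
    rw [hK, card_filter_mem_subset_insert (m - 1) l S hlS, hS]
    exact Nat.choose_symm_of_eq_add (by omega)
  have hpow : 2 ^ (2 * m) = 2 * 2 ^ (2 * m - 1) := by
    rw [← pow_succ']
    congr 1
    omega
  have hsub : ({y : Finset (Fin (2 * m)) | ∀ x ∈ I, m - t ≤ #(symmDiff x y)} : Finset _)
      ⊆ T ∪ K := by
    intro y hy
    simp only [Finset.mem_filter, Finset.mem_univ, true_and] at hy
    have hkey : ∀ x ∈ I, x ⊆ y → m - t ≤ #y - #x := by
      intro x hx hxy
      have := hy x hx
      rwa [symmDiff_of_le hxy, Finset.card_sdiff_of_subset hxy] at this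
    have hym : m ≤ #y := by
      by_contra hlt
      obtain ⟨x, hxy, hxc⟩ := Finset.exists_subset_card_eq (Nat.min_le_right t #y)
      have := hkey x (by
        simp only [I, Finset.mem_filter, Finset.mem_univ, true_and]
        exact Or.inl (by omega)) hxy
      omega
    simp only [hTdef, hK, Finset.mem_union, Finset.mem_filter, Finset.mem_univ, true_and]
    rcases hym.lt_or_eq with h | h
    · exact Or.inl (Or.inl h)
    by_cases hl : l ∈ y
    · refine Or.inr ⟨by omega, hl, ?_⟩
      by_contra hyS
      obtain ⟨j, hjy, hjS⟩ := Finset.not_subset.1 hyS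
      obtain ⟨x, hx1, hxy, hxc⟩ := Finset.exists_subsuperset_card_eq (s := {l, j}) (t := y)
        (n := t + 1) (by
          intro k hk
          rcases Finset.mem_insert.1 hk with rfl | hk
          · exact hl
          · exact Finset.mem_singleton.1 hk ▸ hjy)
        (Finset.card_le_two.trans (by omega)) (by omega)
      have := hkey x (by
        simp only [I, Finset.mem_filter, Finset.mem_univ, true_and]
        exact Or.inr ⟨hxc, hx1 (by simp), fun h => hjS (h (hx1 (by simp)))⟩) hxy
      omega
    · exact Or.inl (Or.inr ⟨h.symm, hl⟩)
  have h1 := Finset.card_le_card hsub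
  have h2 := Finset.card_union_le T K
  omega

theorem card_symmDiff_compl {n : ℕ} (x y : Finset (Fin n)) :
    #(symmDiff x yᶜ) = n - #(symmDiff x y) := by
  have h : symmDiff x yᶜ = (symmDiff x y)ᶜ := by
    ext k
    simp only [Finset.mem_symmDiff, Finset.mem_compl]
    tauto
  rw [h, Finset.card_compl, Fintype.card_fin]

/-- The singleton color classes of a b-coloring, and the complements of the dominating vertices. -/
theorem exists_families_of_hasBColoring {n p k : ℕ} (h : HasBColoring (cubePow n p) k) :
    ∃ A D : Finset (Finset (Fin n)), 2 * k ≤ 2 ^ n + #A ∧ #D = k ∧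
      ∀ x ∈ A, ∀ y ∈ D, n - p ≤ #(symmDiff x y) := by
  classical
  obtain ⟨c, -, hb⟩ := h
  choose f hf hadj using hb
  let A : Finset (Finset (Fin n)) := {v | ∀ w, c w = c v → w = v}
  have hinj : Function.Injective fun i => (f i)ᶜ := by
    intro i j hij
    rw [← hf i, ← hf j, compl_injective hij]
  refine ⟨A, Finset.univ.image fun i => (f i)ᶜ, ?_, ?_, ?_⟩
  · have h1 : 2 ^ n = ∑ i : Fin k, #{x : Finset (Fin n) | c x = i} := by
      rw [← Finset.card_eq_sum_card_fiberwise (s := Finset.univ) (t := Finset.univ)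
        fun _ _ => Finset.mem_coe.2 (Finset.mem_univ _)]
      simp
    have h2 : #A = ∑ i : Fin k, #{x ∈ A | c x = i} :=
      Finset.card_eq_sum_card_fiberwise fun _ _ => Finset.mem_coe.2 (Finset.mem_univ _)
    have h3 : 2 * k = ∑ _i : Fin k, 2 := by simp [mul_comm]
    rw [h1, h2, h3, ← Finset.sum_add_distrib]
    refine Finset.sum_le_sum fun i _ => ?_
    by_cases hi : f i ∈ A
    · have h4 : 0 < #{x : Finset (Fin n) | c x = i} :=
        Finset.card_pos.2 ⟨f i, by simp [hf]⟩
      have h5 : 0 < #{x ∈ A | c x = i} :=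
        Finset.card_pos.2 ⟨f i, by simp [hf, hi]⟩
      omega
    · simp only [A, Finset.mem_filter, Finset.mem_univ, true_and, not_forall] at hi
      obtain ⟨w, hw, hne⟩ := hi
      have h4 : 1 < #{x : Finset (Fin n) | c x = i} :=
        Finset.one_lt_card.2 ⟨w, by simp [hw, hf], f i, by simp [hf], hne⟩
      omega
  · rw [Finset.card_image_of_injective _ hinj, Finset.card_univ, Fintype.card_fin]
  · intro x hx y hy
    obtain ⟨i, -, rfl⟩ := Finset.mem_image.1 hy
    simp only [A, Finset.mem_filter, Finset.mem_univ, true_and] at hx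
    rw [card_symmDiff_compl]
    refine Nat.sub_le_sub_left ?_ n
    by_cases hi : c x = i
    · rw [hx (f i) ((hf i).trans hi.symm)]
      simp
    · obtain ⟨w, hw, hcw⟩ := hadj i (c x) hi
      rw [hx w hcw] at hw
      rw [symmDiff_comm]
      exact hw.2

/-- For even `n ≥ 6` and `n/2 + 1 ≤ p ≤ n-2`, with
`r' = ∑_{i=0}^{p-n/2} C(n,i) + C(n-1, p-n/2)` and `s' = C(p-1, p-n/2)`, `Q_n^p` admits
no b-coloring with more than `2^{n-1} + ⌊(r'-s')/2⌋` colors. -/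
theorem stmt14 (n p : ℕ) (heven : Even n) (hn : 6 ≤ n)
    (hp1 : n / 2 + 1 ≤ p) (hp2 : p ≤ n - 2)
    (r' s' : ℕ)
    (hr : r' = (∑ i ∈ Finset.range (p - n / 2 + 1), Nat.choose n i)
            + Nat.choose (n - 1) (p - n / 2))
    (hs : s' = Nat.choose (p - 1) (p - n / 2))
    (k : ℕ) (h : HasBColoring (cubePow n p) k) :
    k ≤ 2 ^ (n - 1) + (r' - s') / 2 := by
  obtain ⟨A, D, h1, h2, h3⟩ := exists_families_of_hasBColoring h
  obtain ⟨m, rfl⟩ := even_iff_exists_two_mul.1 heven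
  obtain ⟨t, rfl⟩ : ∃ t, p = m + t := ⟨p - m, by omega⟩
  rw [show m + t - 2 * m / 2 = t by omega] at hr hs
  have hpow : 2 ^ (2 * m) = 2 * 2 ^ (2 * m - 1) := by
    rw [← pow_succ']
    congr 1
    omega
  rcases lt_or_ge #A (r' - s') with hA | hA
  · omega
  · have h4 := card_le_two_pow_add_choose (t := t) (by omega) (by omega)
      (fun x hx y hy => (show m - t ≤ 2 * m - (m + t) by omega).trans (h3 x hx y hy))
      (by rwa [← hr, ← hs])
    have h5 := three_mul_choose_le (m := m) (t := t) (by omega) (by omega)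
    rw [← hr, ← hs] at h5
    rw [← hs, h2] at h4
    omega
end

section
/- Let n, q, p be positive integers with 2 ≤ q ≤ n−1 and ⌊n(q−1)/q⌋ ≤ p ≤ n−1. Then the p-th power of the Hamming graph H_{n,q} admits a b-coloring with q^{n−1} colors; consequently b(H_{n,q}^p) ≥ q^{n−1}. -/
open Finset

/-- Pigeonhole: some value of `f : Fin n → ZMod q` is attained at least `n / q` times. -/
lemma exists_le_card_fiber_mul {n q : ℕ} [NeZero q] (f : Fin n → ZMod q) :
    ∃ c, n ≤ (univ.filter fun k => f k = c).card * q := by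
  by_contra! h
  have hsum : ∑ c : ZMod q, (univ.filter fun k => f k = c).card = n := by
    rw [← card_eq_sum_card_fiberwise (fun _ _ => mem_coe.2 (mem_univ _)), card_univ,
      Fintype.card_fin]
  have hlt : ∑ c : ZMod q, (univ.filter fun k => f k = c).card * q < ∑ _c : ZMod q, n :=
    sum_lt_sum_of_nonempty univ_nonempty fun c _ => h c
  rw [← sum_mul, hsum, sum_const, card_univ, ZMod.card, smul_eq_mul, mul_comm] at hlt
  exact lt_irrefl _ hlt

/-- Some translate of `y` by a constant word is within Hamming distance `n(q-1)/q` of `x`. -/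
lemma exists_hammingDist_add_const_le {n q : ℕ} [NeZero q] (x y : Fin n → ZMod q) :
    ∃ c, hammingDist x (fun k => y k + c) ≤ n * (q - 1) / q := by
  obtain ⟨c, hc⟩ := exists_le_card_fiber_mul fun k => x k - y k
  refine ⟨c, ?_⟩
  have hq : 0 < q := Nat.pos_of_ne_zero (NeZero.ne q)
  have hadd : (univ.filter fun k => x k - y k = c).card + hammingDist x (fun k => y k + c) = n := by
    have hd : hammingDist x (fun k => y k + c) = (univ.filter fun k => ¬ x k - y k = c).card := by
      simp only [hammingDist, sub_eq_iff_eq_add', ne_eq]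
    rw [hd, card_filter_add_card_filter_not, card_univ, Fintype.card_fin]
  rw [Nat.le_div_iff_mul_le hq, Nat.mul_sub, mul_one]
  refine Nat.le_sub_of_add_le ?_
  calc _ ≤ hammingDist x (fun k => y k + c) * q
        + (univ.filter fun k => x k - y k = c).card * q := Nat.add_le_add_left hc _
    _ = n * q := by rw [← add_mul, add_comm, hadd]

/-- For positive integers `n, q, p` with `2 ≤ q ≤ n-1` and `⌊n(q-1)/q⌋ ≤ p ≤ n-1`, the
`p`-th power of the Hamming graph `H_{n,q}` admits a b-coloring with `q^{n-1}` colors. -/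
theorem stmt15 (n q p : ℕ) (hn : 1 ≤ n) (hp0 : 1 ≤ p) (hq1 : 2 ≤ q) (hq2 : q ≤ n - 1)
    (hp1 : n * (q - 1) / q ≤ p) (hp2 : p ≤ n - 1) :
    HasBColoring (hammingPow n q p) (q ^ (n - 1)) := by
  have : NeZero q := ⟨by omega⟩
  obtain ⟨m, rfl⟩ : ∃ m, n = m + 1 := ⟨n - 1, by omega⟩
  simp only [Nat.add_sub_cancel] at hp2 ⊢
  let e : (Fin m → ZMod q) ≃ Fin (q ^ m) := Fintype.equivFinOfCardEq (by simp [ZMod.card])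
  let r : (Fin (m + 1) → ZMod q) → Fin m → ZMod q := fun x i => x i.succ - x 0
  have hr : ∀ g c, r (fun k => (Fin.cons 0 g : Fin (m + 1) → ZMod q) k + c) = g := fun g c => by
    ext i; simp [r]
  refine ⟨fun x => e (r x), fun x y hxy heq => ?_, fun i => ?_⟩
  · have hr' : r x = r y := e.injective heq
    have hne : ∀ k, x k ≠ y k := by
      intro k hk
      have hdiff : ∀ k, x k - x 0 = y k - y 0 := Fin.cases (by simp) (congrFun hr')
      have h0 : x 0 = y 0 := by simpa [hk] using hdiff k
      have hxy' : x = y := by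
        funext l
        simpa [h0] using hdiff l
      exact hxy.ne hxy'
    have hd : hammingDist x y = m + 1 := by simp [hammingDist, hne]
    have := hxy.2
    omega
  · refine ⟨Fin.cons 0 (e.symm i), ?_, fun j hj => ?_⟩
    · simpa [← Equiv.eq_symm_apply] using hr (e.symm i) 0
    · obtain ⟨c, hc⟩ := exists_hammingDist_add_const_le
        (Fin.cons 0 (e.symm i) : Fin (m + 1) → ZMod q) (Fin.cons 0 (e.symm j))
      refine ⟨_, ⟨Nat.one_le_iff_ne_zero.2 (hammingDist_ne_zero.2 fun heq => hj ?_),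
        hc.trans hp1⟩, by simp [hr]⟩
      have h1 := congrArg r heq
      rw [hr] at h1
      have h2 : r (Fin.cons 0 (e.symm i)) = e.symm i := by simpa using hr (e.symm i) 0
      exact (e.symm.injective (h2.symm.trans h1)).symm
end

section
/- Let q ≥ 2 and n ≥ 1 be integers. Then the (n−1)-th power of the Hamming graph H_{n,q} admits a b-coloring with q^{n−1} colors; consequently b(H_{n,q}^{n−1}) ≥ q^{n−1}. -/
open Finset

/-- A tuple colored by the differences of its later entries with its first one: two distinct
tuples of the same color differ in every coordinate. -/
def firstDiff {m q : ℕ} (x : Fin (m + 1) → ZMod q) : Fin m → ZMod q :=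
  fun i => x i.succ - x 0

theorem firstDiff_cons_zero {m q : ℕ} (a : Fin m → ZMod q) :
    firstDiff (Fin.cons 0 a : Fin (m + 1) → ZMod q) = a := by
  ext i
  simp [firstDiff]

theorem eq_of_firstDiff_eq {m q : ℕ} {x y : Fin (m + 1) → ZMod q}
    (h : firstDiff x = firstDiff y) {i : Fin (m + 1)} (hi : x i = y i) : x = y := by
  have hsub : ∀ j : Fin m, x j.succ - x 0 = y j.succ - y 0 := fun j => congrFun h j
  have h0 : x 0 = y 0 := by
    cases i using Fin.cases with
    | zero => exact hi
    | succ j => simpa [hi] using hsub j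
  ext j
  cases j using Fin.cases with
  | zero => exact h0
  | succ j => simpa [h0] using hsub j

theorem hammingDist_le_iff_exists_eq {m : ℕ} {β : Type*} [DecidableEq β]
    (x y : Fin (m + 1) → β) : hammingDist x y ≤ m ↔ ∃ i, x i = y i := by
  rw [← Nat.lt_succ_iff, hammingDist]
  have h := Finset.card_lt_iff_ne_univ (univ.filter fun i => x i ≠ y i)
  rw [Fintype.card_fin] at h
  rw [Nat.succ_eq_add_one, h]
  simp [Finset.filter_eq_self]

theorem hammingPow_adj_iff {m q : ℕ} (x y : Fin (m + 1) → ZMod q) :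
    (hammingPow (m + 1) q m).Adj x y ↔ x ≠ y ∧ ∃ i, x i = y i := by
  rw [← hammingDist_le_iff_exists_eq, ← hammingDist_pos]
  rfl

/-- For `q ≥ 2` and `n ≥ 1`, the `(n-1)`-th power of the Hamming graph `H_{n,q}` admits a
b-coloring with `q^{n-1}` colors. -/
theorem stmt16 (n q : ℕ) (hq : 2 ≤ q) (hn : 1 ≤ n) :
    HasBColoring (hammingPow n q (n - 1)) (q ^ (n - 1)) := by
  obtain ⟨m, rfl⟩ : ∃ m, n = m + 1 := ⟨n - 1, by omega⟩
  rw [Nat.add_sub_cancel]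
  have : NeZero q := ⟨by omega⟩
  let e : (Fin m → ZMod q) ≃ Fin (q ^ m) := Fintype.equivFinOfCardEq (by simp)
  refine ⟨fun x => e (firstDiff x), fun x y hxy hc => ?_, fun i => ?_⟩
  · obtain ⟨hne, k, hk⟩ := (hammingPow_adj_iff x y).1 hxy
    exact hne (eq_of_firstDiff_eq (e.injective hc) hk)
  · refine ⟨Fin.cons 0 (e.symm i), by simp [firstDiff_cons_zero], fun j hj => ?_⟩
    refine ⟨Fin.cons 0 (e.symm j), ?_, by simp [firstDiff_cons_zero]⟩
    rw [hammingPow_adj_iff]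
    exact ⟨fun h => hj (e.symm.injective (Fin.cons_right_injective _ h)).symm, 0, rfl⟩
end

section
/- Let n be odd, n ≥ 5, and (n+1)/2 ≤ p ≤ n−2, and set r = Σ_{i=0}^{p−(n−1)/2} C(n,i). Then C^p[I_r] = I_{2^{n−1}}; that is, the common p-neighborhood of the initial segment of size r is exactly the initial segment consisting of the first 2^{n−1} subsets of [n]. -/
open Finset

theorem not_simpLT_self {n : ℕ} (x : Finset (Fin n)) : ¬ SimpLT x x := by
  rintro (h | ⟨-, i, hi, hi', -⟩)
  · exact lt_irrefl _ h
  · exact hi' hi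

theorem card_filter_card_lt (n k : ℕ) :
    (univ.filter fun x : Finset (Fin n) => x.card < k).card
      = ∑ i ∈ range k, n.choose i := by
  rw [card_eq_sum_card_fiberwise (f := Finset.card) (t := range k) (by intro x; simp)]
  refine sum_congr rfl fun i hi => ?_
  have hc : n.choose i = (powersetCard i (univ : Finset (Fin n))).card := by simp
  rw [hc]
  congr 1
  ext x
  simp only [mem_range] at hi
  simp only [mem_filter, mem_univ, true_and, mem_powersetCard, subset_univ]
  omega

/-- The initial segment of size `∑ i < k, C(n, i)` is the open Hamming ball of radius `k`. -/
theorem ISeg_sum_choose (n k : ℕ) :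
    ISeg n (∑ i ∈ range k, n.choose i) = univ.filter fun x => x.card < k := by
  ext x
  simp only [ISeg, mem_filter, mem_univ, true_and, ← card_filter_card_lt]
  constructor
  · intro h
    by_contra! hx
    refine absurd h (not_lt.mpr (card_le_card fun z hz => ?_))
    simp only [mem_filter, mem_univ, true_and] at hz ⊢
    exact Or.inl (hz.trans_le hx)
  · intro hx
    refine card_lt_card ((ssubset_iff_of_subset fun z hz => ?_).mpr ⟨x, ?_, ?_⟩)
    · simp only [mem_filter, mem_univ, true_and] at hz ⊢
      rcases hz with h | ⟨h, -⟩ <;> omega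
    · simpa using hx
    · simpa using not_simpLT_self x

/-- The common `(m + k)`-neighborhood of the Hamming ball of radius `k` is the Hamming ball of
radius `m`, provided `m + k < n`. -/
theorem Cball_filter_card_lt {n m k : ℕ} (h : m + k < n) :
    Cball n (m + k) (univ.filter fun x => x.card < k + 1)
      = univ.filter fun x => x.card < m + 1 := by
  ext y
  simp only [Cball, mem_filter, mem_univ, true_and]
  constructor
  · intro hy
    by_contra! hm
    have hc : yᶜ.card = n - y.card := by simp [card_compl]
    have hyn : y.card ≤ n := by simpa using card_le_univ y
    obtain ⟨x, hxy, hx⟩ := exists_subset_card_eq (s := yᶜ) (n := min k (n - y.card))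
      (by rw [hc]; exact min_le_right _ _)
    have hd : Disjoint x y := disjoint_left.mpr fun a ha => mem_compl.mp (hxy ha)
    have hle := hy x (by omega)
    rw [hd.symmDiff_eq_sup, sup_eq_union, card_union_of_disjoint hd] at hle
    omega
  · intro hy x hx
    have hle : (symmDiff x y).card ≤ (x ∪ y).card :=
      card_le_card symmDiff_le_sup
    have := card_union_le x y
    omega

/-- For odd `n ≥ 5` and `(n+1)/2 ≤ p ≤ n-2`, with `r = ∑_{i=0}^{p-(n-1)/2} C(n,i)`,
the common `p`-neighborhood of `I_r` is exactly `I_{2^{n-1}}`. -/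
theorem stmt18 (n p : ℕ) (hodd : Odd n) (hn : 5 ≤ n)
    (hp1 : (n + 1) / 2 ≤ p) (hp2 : p ≤ n - 2)
    (r : ℕ) (hr : r = ∑ i ∈ Finset.range (p - (n - 1) / 2 + 1), Nat.choose n i) :
    Cball n p (ISeg n r) = ISeg n (2 ^ (n - 1)) := by
  obtain ⟨m, rfl⟩ := hodd
  obtain ⟨k, rfl⟩ : ∃ k, p = m + k := ⟨p - m, by omega⟩
  have hk : m + k - (2 * m + 1 - 1) / 2 + 1 = k + 1 := by omega
  have hpow : 2 ^ (2 * m + 1 - 1) = ∑ i ∈ range (m + 1), (2 * m + 1).choose i := by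
    rw [Nat.sum_range_choose_halfway, Nat.add_sub_cancel, pow_mul]
    norm_num
  rw [hr, hk, hpow, ISeg_sum_choose, ISeg_sum_choose, Cball_filter_card_lt (by omega)]
end
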